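/- arXiv:1403.3777 — 4 statements merged into one kernel-verified Lean document; each statement's English description precedes it below -/
import Mathlib

section
/- Let X be a Banach space with an unconditional, bidemocratic Schauder basis (e_i). Then for every ε > 0 there is an equivalent norm on X with respect to which (e_i) is 1-unconditional, 1-bidemocratic and (1+ε)-greedy. -/
open scoped BigOperators

section CommonDefs

variable {X : Type*} [NormedAddCommGroup X] [NormedSpace ℝ X]

/-- `(e, coord)` is a Schauder basis of `X` with biorthogonal functionals `coord`:
the functionals are biorthogonal to the basis vectors and every `x` is the limit of the
partial sums of its expansion `Σ coord i x • e i`. -/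
structure IsSchauderBasis (e : ℕ → X) (coord : ℕ → X →L[ℝ] ℝ) : Prop where
  biorth : ∀ i j, coord i (e j) = if i = j then 1 else 0
  expansion : ∀ x : X,
    Filter.Tendsto (fun n => ∑ i ∈ Finset.range n, coord i x • e i)
      Filter.atTop (nhds x)

/-- The best `m`-term approximation error `σ_m(x)` w.r.t. the norm `nn`. -/
noncomputable def bestApprox (e : ℕ → X) (nn : X → ℝ) (m : ℕ) (x : X) : ℝ :=
  sInf { r | ∃ (A : Finset ℕ) (a : ℕ → ℝ), A.card ≤ m ∧
    r = nn (x - ∑ i ∈ A, a i • e i) }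

/-- `A` is a set of coordinates of `x` of largest modulus (a greedy set):
the `m`-th greedy approximant of `x` is `∑ i ∈ A, coord i x • e i` for a greedy set of
cardinality `m`. -/
def GreedySet (coord : ℕ → X →L[ℝ] ℝ) (x : X) (A : Finset ℕ) : Prop :=
  ∀ i ∈ A, ∀ j ∉ A, |coord j x| ≤ |coord i x|

/-- The basis `(e, coord)` is `C`-greedy w.r.t. the norm `nn`:
`‖x - G_m(x)‖ ≤ C σ_m(x)` for every `x` and `m` (for any choice of `m`-th greedy
approximant `G_m(x)`). -/
def IsGreedyWith (e : ℕ → X) (coord : ℕ → X →L[ℝ] ℝ) (nn : X → ℝ) (C : ℝ) : Prop :=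
  ∀ (x : X) (m : ℕ) (A : Finset ℕ), A.card = m → GreedySet coord x A →
    nn (x - ∑ i ∈ A, coord i x • e i) ≤ C * bestApprox e nn m x

/-- Suppression `K`-unconditionality w.r.t. the norm `nn`. -/
def IsSuppressionUnconditionalWith (e : ℕ → X) (nn : X → ℝ) (K : ℝ) : Prop :=
  ∀ (s A : Finset ℕ) (a : ℕ → ℝ), A ⊆ s →
    nn (∑ i ∈ A, a i • e i) ≤ K * nn (∑ i ∈ s, a i • e i)

/-- `K`-unconditionality w.r.t. the norm `nn`. -/
def IsUnconditionalWith (e : ℕ → X) (nn : X → ℝ) (K : ℝ) : Prop :=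
  ∀ (s : Finset ℕ) (a b : ℕ → ℝ), (∀ i, |a i| ≤ |b i|) →
    nn (∑ i ∈ s, a i • e i) ≤ K * nn (∑ i ∈ s, b i • e i)

/-- `Δ`-democracy w.r.t. the norm `nn`. -/
def IsDemocraticWith (e : ℕ → X) (nn : X → ℝ) (Δ : ℝ) : Prop :=
  ∀ A B : Finset ℕ, A.card ≤ B.card →
    nn (∑ i ∈ A, e i) ≤ Δ * nn (∑ i ∈ B, e i)

/-- The basis is normalized w.r.t. the norm `nn`. -/
def IsNormalizedWith (e : ℕ → X) (nn : X → ℝ) : Prop :=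
  ∀ i, nn (e i) = 1

/-- The basis is seminormalized. -/
def IsSeminormalized (e : ℕ → X) : Prop :=
  ∃ c C : ℝ, 0 < c ∧ ∀ i, c ≤ ‖e i‖ ∧ ‖e i‖ ≤ C

/-- The fundamental function `φ(n) = sup_{|A| ≤ n} ‖Σ_{i∈A} e_i‖` w.r.t. the norm `nn`. -/
noncomputable def fundFn (e : ℕ → X) (nn : X → ℝ) (n : ℕ) : ℝ :=
  sSup { r | ∃ A : Finset ℕ, A.card ≤ n ∧ r = nn (∑ i ∈ A, e i) }

/-- The dual norm (w.r.t. `nn`) of `∑_{i∈A} e_i^*`. -/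
noncomputable def dualNormFinset (coord : ℕ → X →L[ℝ] ℝ) (nn : X → ℝ) (A : Finset ℕ) : ℝ :=
  sSup { r | ∃ x : X, nn x ≤ 1 ∧ r = |∑ i ∈ A, coord i x| }

/-- The dual fundamental function `φ*(n) = sup_{|A| ≤ n} ‖Σ_{i∈A} e_i^*‖*` w.r.t. `nn`. -/
noncomputable def dualFundFn (coord : ℕ → X →L[ℝ] ℝ) (nn : X → ℝ) (n : ℕ) : ℝ :=
  sSup { r | ∃ A : Finset ℕ, A.card ≤ n ∧ r = dualNormFinset coord nn A }

/-- `Δ`-bidemocracy w.r.t. the norm `nn`: `φ(n) φ*(n) ≤ Δ n` for all `n`. -/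
def IsBidemocraticWith (e : ℕ → X) (coord : ℕ → X →L[ℝ] ℝ) (nn : X → ℝ) (Δ : ℝ) : Prop :=
  ∀ n : ℕ, fundFn e nn n * dualFundFn coord nn n ≤ Δ * n

/-- `nn` is a norm on `X` equivalent to the original norm. -/
def IsEquivNorm (nn : X → ℝ) : Prop :=
  (∀ x y : X, nn (x + y) ≤ nn x + nn y) ∧
  (∀ (a : ℝ) (x : X), nn (a • x) = |a| * nn x) ∧
  ∃ c C : ℝ, 0 < c ∧ ∀ x : X, c * ‖x‖ ≤ nn x ∧ nn x ≤ C * ‖x‖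

/-- The (finitely supported) vector `Σ_i f i • e i` with coefficients `f ∈ c₀₀`. -/
noncomputable def finVec (e : ℕ → X) (f : ℕ →₀ ℝ) : X :=
  f.sum fun i c => c • e i

/-- `y = w + t` is a greedy rearrangement of `x = w + u`: the coefficient sequences
`w, u, t` have pairwise disjoint supports, `|supp u| = |supp t|`, and
`‖w‖_∞ ≤ |u_i| = |t_j|` for all `i ∈ supp u`, `j ∈ supp t`. -/
def IsGreedyRearrangement (w u t : ℕ →₀ ℝ) : Prop :=
  Disjoint w.support u.support ∧ Disjoint w.support t.support ∧
  Disjoint u.support t.support ∧ u.support.card = t.support.card ∧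
  (∀ i ∈ u.support, ∀ j ∈ t.support, |u i| = |t j|) ∧
  (∀ n : ℕ, ∀ i ∈ u.support, |w n| ≤ |u i|)

end CommonDefs

section FundDefs

/-- A fundamental (quasi-concave) function on `[1, ∞)`: positive, increasing, and
`x ↦ φ(x)/x` is decreasing. -/
def IsFundamentalFunction (φ : ℝ → ℝ) : Prop :=
  (∀ x : ℝ, 1 ≤ x → 0 < φ x) ∧
  (∀ x y : ℝ, 1 ≤ x → x ≤ y → φ x ≤ φ y) ∧
  (∀ x y : ℝ, 1 ≤ x → x ≤ y → φ y / y ≤ φ x / x)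

/-- `δ_φ(y) = liminf_{x→∞} φ(yx)/(y φ(x))`. -/
noncomputable def deltaFn (φ : ℝ → ℝ) (y : ℝ) : ℝ :=
  Filter.liminf (fun x : ℝ => φ (y * x) / (y * φ x)) Filter.atTop

/-- `δ(φ) = inf_{y ≥ 1} δ_φ(y)`. -/
noncomputable def deltaParam (φ : ℝ → ℝ) : ℝ :=
  sInf { d | ∃ y : ℝ, 1 ≤ y ∧ d = deltaFn φ y }

/-- Equivalence of fundamental functions. -/
def FundEquiv (φ ψ : ℝ → ℝ) : Prop :=
  ∃ a b : ℝ, 0 < a ∧ 0 < b ∧ ∀ x : ℝ, 1 ≤ x → a * φ x ≤ ψ x ∧ ψ x ≤ b * φ x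

end FundDefs

section Helpers

variable {X : Type*} [NormedAddCommGroup X] [NormedSpace ℝ X]

lemma hl_iSup_props {ι : Type*} [Nonempty ι] (f : ι → X → ℝ) (C : ℝ)
    (hsub : ∀ i x y, f i (x + y) ≤ f i x + f i y)
    (hhom : ∀ i (a : ℝ) x, f i (a • x) = |a| * f i x)
    (hbd : ∀ i x, f i x ≤ C * ‖x‖) :
    (∀ i x, f i x ≤ ⨆ j, f j x) ∧
    (∀ x y, (⨆ i, f i (x + y)) ≤ (⨆ i, f i x) + ⨆ i, f i y) ∧
    (∀ (a : ℝ) x, (⨆ i, f i (a • x)) = |a| * ⨆ i, f i x) ∧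
    (∀ x, (⨆ i, f i x) ≤ C * ‖x‖) := by
  have hle : ∀ i x, f i x ≤ ⨆ j, f j x := fun i x =>
    le_ciSup (f := fun j => f j x) ⟨C * ‖x‖, by rintro _ ⟨j, rfl⟩; exact hbd j x⟩ i
  refine ⟨hle, fun x y => ciSup_le fun i => ?_, fun a x => ?_, fun x => ciSup_le fun i => hbd i x⟩
  · exact (hsub i x y).trans (add_le_add (hle i x) (hle i y))
  · simp only [hhom]
    rw [Real.mul_iSup_of_nonneg (abs_nonneg a)]

lemma hl_coord_sum {e : ℕ → X} {coord : ℕ → X →L[ℝ] ℝ} (hb : IsSchauderBasis e coord)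
    (A : Finset ℕ) (a : ℕ → ℝ) (j : ℕ) :
    coord j (∑ i ∈ A, a i • e i) = if j ∈ A then a j else 0 := by
  simp [map_sum, hb.biorth]

lemma hl_coord_ind {e : ℕ → X} {coord : ℕ → X →L[ℝ] ℝ} (hb : IsSchauderBasis e coord)
    (A : Finset ℕ) (j : ℕ) :
    coord j (∑ i ∈ A, e i) = if j ∈ A then 1 else 0 := by
  simp [map_sum, hb.biorth]

lemma hl_bdd_mult {e : ℕ → X} {coord : ℕ → X →L[ℝ] ℝ} (hb : IsSchauderBasis e coord)
    {K : ℝ} (hK : IsUnconditionalWith e (fun x => ‖x‖) K) (x : X) (s : Finset ℕ)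
    (a : ℕ → ℝ) (ha : ∀ i ∈ s, |a i| ≤ |coord i x|) :
    ‖∑ i ∈ s, a i • e i‖ ≤ K * ‖x‖ := by
  have hlim := ((hb.expansion x).norm).const_mul K
  refine ge_of_tendsto hlim ?_
  obtain ⟨n0, hn0⟩ := s.exists_nat_subset_range
  filter_upwards [Filter.eventually_ge_atTop n0] with n hn
  have hsub : s ⊆ Finset.range n := hn0.trans (Finset.range_mono hn)
  have h := hK (Finset.range n) (fun i => if i ∈ s then a i else 0) (fun i => coord i x) (by
    intro i
    by_cases hi : i ∈ s
    · simpa [hi] using ha i hi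
    · simp [hi])
  have heq : ∑ i ∈ Finset.range n, (if i ∈ s then a i else 0) • e i = ∑ i ∈ s, a i • e i := by
    rw [← Finset.sum_subset hsub]
    · exact Finset.sum_congr rfl fun i hi => by simp [hi]
    · intro i _ hi; simp [hi]
  simpa only [heq] using h

/-- index set for the multiplier norm -/
abbrev HlIdx := Finset ℕ × {θ : ℕ → ℝ // ∀ i, |θ i| ≤ 1}

instance : Nonempty HlIdx := ⟨(∅, ⟨fun _ => 0, by simp⟩)⟩

/-- multiplier norm -/
noncomputable def hlN (e : ℕ → X) (coord : ℕ → X →L[ℝ] ℝ) (x : X) : ℝ :=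
  ⨆ p : HlIdx, ‖∑ i ∈ p.1, (p.2.1 i * coord i x) • e i‖

/-- Marcinkiewicz norm -/
noncomputable def hlM (φ : ℕ → ℝ) (coord : ℕ → X →L[ℝ] ℝ) (x : X) : ℝ :=
  ⨆ E : Finset ℕ, φ E.card / E.card * ∑ i ∈ E, |coord i x|

lemma hlN_props {e : ℕ → X} {coord : ℕ → X →L[ℝ] ℝ} (hb : IsSchauderBasis e coord)
    {K : ℝ} (hK : IsUnconditionalWith e (fun x => ‖x‖) K) :
    (∀ x y, hlN e coord (x + y) ≤ hlN e coord x + hlN e coord y) ∧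
    (∀ (a : ℝ) x, hlN e coord (a • x) = |a| * hlN e coord x) ∧
    (∀ x, hlN e coord x ≤ K * ‖x‖) ∧ (∀ x, ‖x‖ ≤ hlN e coord x) ∧
    (∀ x y, (∀ i, |coord i x| ≤ |coord i y|) → hlN e coord x ≤ hlN e coord y) := by
  obtain ⟨h1, h2, h3, h4⟩ := hl_iSup_props
    (fun (p : HlIdx) (x : X) => ‖∑ i ∈ p.1, (p.2.1 i * coord i x) • e i‖) K
    (by
      intro p x y
      simp only [map_add, mul_add, add_smul, Finset.sum_add_distrib]
      exact norm_add_le _ _)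
    (by
      intro p a x
      rw [← Real.norm_eq_abs, ← norm_smul, Finset.smul_sum]
      congr 1
      refine Finset.sum_congr rfl fun i _ => ?_
      rw [smul_smul, map_smul, smul_eq_mul]
      ring_nf)
    (by
      intro p x
      refine hl_bdd_mult hb hK x p.1 _ fun i _ => ?_
      rw [abs_mul]
      exact mul_le_of_le_one_left (abs_nonneg _) (p.2.2 i))
  refine ⟨h2, h3, h4, fun x => ?_, fun x y hxy => ciSup_le fun p => ?_⟩
  · refine le_of_tendsto (hb.expansion x).norm (Filter.Eventually.of_forall fun n => ?_)
    simpa [hlN] using h1 (Finset.range n, ⟨fun _ => 1, by simp⟩) x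
  · have := h1 (p.1, ⟨fun i => p.2.1 i * (coord i x / coord i y), fun i => by
      rw [abs_mul, abs_div]
      exact mul_le_one₀ (p.2.2 i) (by positivity) (div_le_one_of_le₀ (hxy i) (abs_nonneg _))⟩) y
    refine le_trans (le_of_eq ?_) this
    congr 1
    refine Finset.sum_congr rfl fun i _ => ?_
    congr 1
    by_cases h0 : coord i y = 0
    · have := hxy i
      rw [h0, abs_zero] at this
      have : coord i x = 0 := abs_eq_zero.1 (le_antisymm this (abs_nonneg _))
      simp [this]
    · field_simp

lemma hlM_props {coord : ℕ → X →L[ℝ] ℝ} {φ : ℕ → ℝ} (hφ : ∀ n, 0 ≤ φ n) {C : ℝ}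
    (hC : ∀ (E : Finset ℕ) x, φ E.card / E.card * ∑ i ∈ E, |coord i x| ≤ C * ‖x‖) :
    (∀ x y, hlM φ coord (x + y) ≤ hlM φ coord x + hlM φ coord y) ∧
    (∀ (a : ℝ) x, hlM φ coord (a • x) = |a| * hlM φ coord x) ∧
    (∀ x, hlM φ coord x ≤ C * ‖x‖) ∧
    (∀ (E : Finset ℕ) x, φ E.card / E.card * ∑ i ∈ E, |coord i x| ≤ hlM φ coord x) := by
  obtain ⟨h1, h2, h3, h4⟩ := hl_iSup_props
    (fun (E : Finset ℕ) (x : X) => φ E.card / E.card * ∑ i ∈ E, |coord i x|) C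
    (by
      intro E x y
      rw [← mul_add, ← Finset.sum_add_distrib]
      refine mul_le_mul_of_nonneg_left (Finset.sum_le_sum fun i _ => ?_)
        (div_nonneg (hφ _) (Nat.cast_nonneg _))
      rw [map_add]
      exact abs_add_le _ _)
    (by
      intro E a x
      simp only [map_smul, smul_eq_mul, abs_mul, ← Finset.mul_sum]
      ring)
    hC
  exact ⟨h2, h3, h4, h1⟩

lemma hl_fund {e : ℕ → X} (hsemi : IsSeminormalized e) :
    (∀ A : Finset ℕ, ∀ n, A.card ≤ n → ‖∑ i ∈ A, e i‖ ≤ fundFn e (fun x => ‖x‖) n) ∧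
    (fundFn e (fun x => ‖x‖) 0 = 0) ∧
    (∀ n, 0 < n → 0 < fundFn e (fun x => ‖x‖) n) ∧
    (Monotone (fundFn e (fun x => ‖x‖))) ∧
    (∀ n m, 0 < n → n ≤ m →
      fundFn e (fun x => ‖x‖) m / m ≤ fundFn e (fun x => ‖x‖) n / n) := by
  obtain ⟨c, C, hc, hcC⟩ := hsemi
  have hC : 0 ≤ C := hc.le.trans ((hcC 0).1.trans (hcC 0).2)
  have hle : ∀ A : Finset ℕ, ∀ n, A.card ≤ n → ‖∑ i ∈ A, e i‖ ≤ fundFn e (fun x => ‖x‖) n := by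
    intro A n hA
    refine le_csSup ⟨n * C, ?_⟩ ⟨A, hA, rfl⟩
    rintro _ ⟨B, hB, rfl⟩
    calc ‖∑ i ∈ B, e i‖ ≤ ∑ i ∈ B, ‖e i‖ := norm_sum_le _ _
      _ ≤ ∑ i ∈ B, C := Finset.sum_le_sum fun i _ => (hcC i).2
      _ = B.card * C := by simp
      _ ≤ n * C := by gcongr
  have hnn : ∀ n, 0 ≤ fundFn e (fun x => ‖x‖) n := fun n => by
    simpa using hle ∅ n (by simp)
  have hmono : Monotone (fundFn e (fun x => ‖x‖)) := by
    intro n m hnm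
    refine Real.sSup_le ?_ (hnn m)
    rintro _ ⟨B, hB, rfl⟩
    exact hle B m (hB.trans hnm)
  refine ⟨hle, ?_, ?_, hmono, ?_⟩
  · refine le_antisymm (Real.sSup_le ?_ le_rfl) (hnn 0)
    rintro _ ⟨B, hB, rfl⟩
    have : B = ∅ := by simpa using hB
    simp [this]
  · intro n hn
    refine hc.trans_le ((hcC 0).1.trans ?_)
    simpa using hle {0} n (by simp; omega)
  · intro n m hn hnm
    induction m, hnm using Nat.le_induction with
    | base => exact le_rfl
    | succ m hm ih =>
      refine le_trans ?_ ih
      have hm0 : 0 < m := hn.trans_le hm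
      have hmR : (0 : ℝ) < m := by exact_mod_cast hm0
      rw [div_le_iff₀ (by positivity)]
      refine Real.sSup_le ?_ (mul_nonneg (div_nonneg (hnn m) hmR.le) (by positivity))
      rintro _ ⟨A, hA, rfl⟩
      rw [div_mul_eq_mul_div, le_div_iff₀ hmR]
      rcases Nat.lt_or_ge m A.card with h | h
      · have hAc : A.card = m + 1 := le_antisymm hA h
        have key : ∑ i ∈ A, ∑ j ∈ A.erase i, e j = (m : ℝ) • ∑ j ∈ A, e j := by
          have : ∀ i ∈ A, ∑ j ∈ A.erase i, e j = ∑ j ∈ A, e j - e i := fun i hi => by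
            rw [← Finset.add_sum_erase A e hi]; abel
          rw [Finset.sum_congr rfl this, Finset.sum_sub_distrib, Finset.sum_const, hAc,
            ← Nat.cast_smul_eq_nsmul ℝ]
          push_cast
          rw [add_smul, one_smul]; abel
        calc ‖∑ i ∈ A, e i‖ * m = ‖(m : ℝ) • ∑ j ∈ A, e j‖ := by
              rw [norm_smul, Real.norm_of_nonneg hmR.le, mul_comm]
          _ = ‖∑ i ∈ A, ∑ j ∈ A.erase i, e j‖ := by rw [key]
          _ ≤ ∑ i ∈ A, ‖∑ j ∈ A.erase i, e j‖ := norm_sum_le _ _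
          _ ≤ ∑ i ∈ A, fundFn e (fun x => ‖x‖) m := Finset.sum_le_sum fun i hi =>
              hle _ _ (by rw [Finset.card_erase_of_mem hi, hAc]; simp)
          _ = fundFn e (fun x => ‖x‖) m * ((m + 1 : ℕ) : ℝ) := by
              rw [Finset.sum_const, hAc, nsmul_eq_mul, mul_comm]
      · have h1 := hle A m h
        have h2 := hnn m
        push_cast
        nlinarith

lemma hl_dual_bound {e : ℕ → X} {coord : ℕ → X →L[ℝ] ℝ} (hb : IsSchauderBasis e coord)
    (hsemi : IsSeminormalized e)
    {K : ℝ} (hK : IsUnconditionalWith e (fun x => ‖x‖) K) (hK0 : 0 ≤ K)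
    {Δ : ℝ} (hΔ : IsBidemocraticWith e coord (fun x => ‖x‖) Δ)
    (E : Finset ℕ) (x : X) :
    fundFn e (fun x => ‖x‖) E.card / E.card * ∑ i ∈ E, |coord i x| ≤ |Δ| * K * ‖x‖ := by
  obtain ⟨c, C, hc, hcC⟩ := id hsemi
  obtain ⟨-, -, hpos, -, -⟩ := hl_fund hsemi
  rcases Finset.eq_empty_or_nonempty E with rfl | hE
  · simp; positivity
  have hcoord : ∀ i x, |coord i x| ≤ K / c * ‖x‖ := by
    intro i x
    have h := hl_bdd_mult hb hK x {i} (fun i => coord i x) (by simp)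
    rw [Finset.sum_singleton, norm_smul, Real.norm_eq_abs] at h
    rw [div_mul_eq_mul_div, le_div_iff₀ hc]
    exact (mul_le_mul_of_nonneg_left (hcC i).1 (abs_nonneg _)).trans h
  have hsum : ∀ (A : Finset ℕ) (y : X), ‖y‖ ≤ 1 → |∑ i ∈ A, coord i y| ≤ A.card * (K / c) := by
    intro A y hy
    calc |∑ i ∈ A, coord i y| ≤ ∑ i ∈ A, |coord i y| := Finset.abs_sum_le_sum_abs _ _
      _ ≤ ∑ i ∈ A, K / c := Finset.sum_le_sum fun i _ =>
          (hcoord i y).trans (mul_le_of_le_one_right (by positivity) hy)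
      _ = _ := by simp
  have hdn : ∀ (A : Finset ℕ) (y : X), ‖y‖ ≤ 1 →
      |∑ i ∈ A, coord i y| ≤ dualFundFn coord (fun x => ‖x‖) A.card := by
    intro A y hy
    have h1 : |∑ i ∈ A, coord i y| ≤ dualNormFinset coord (fun x => ‖x‖) A := by
      refine le_csSup ⟨A.card * (K / c), ?_⟩ ⟨y, hy, rfl⟩
      rintro _ ⟨z, hz, rfl⟩
      exact hsum A z hz
    refine h1.trans (le_csSup ⟨A.card * (K / c), ?_⟩ ⟨A, le_rfl, rfl⟩)
    rintro _ ⟨B, hB, rfl⟩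
    refine Real.sSup_le ?_ (by positivity)
    rintro _ ⟨z, hz, rfl⟩
    refine (hsum B z hz).trans ?_
    gcongr
  have hdn' : ∀ (A : Finset ℕ) (y : X),
      |∑ i ∈ A, coord i y| ≤ dualFundFn coord (fun x => ‖x‖) A.card * ‖y‖ := by
    intro A y
    rcases eq_or_ne y 0 with rfl | hy
    · simp
    have hy0 : 0 < ‖y‖ := norm_pos_iff.2 hy
    have h := hdn A (‖y‖⁻¹ • y) (by rw [norm_smul, norm_inv, norm_norm, inv_mul_cancel₀ hy0.ne'])
    simp only [map_smul, smul_eq_mul, ← Finset.mul_sum] at h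
    rw [abs_mul, abs_of_pos (inv_pos.2 hy0), inv_mul_le_iff₀ hy0] at h
    linarith
  have hy := hl_bdd_mult hb hK x E (fun i => |coord i x|) (by simp)
  have h := hdn' E (∑ i ∈ E, |coord i x| • e i)
  have hs : ∑ i ∈ E, coord i (∑ j ∈ E, |coord j x| • e j) = ∑ i ∈ E, |coord i x| :=
    Finset.sum_congr rfl fun i hi => by
      rw [hl_coord_sum hb E (fun j => |coord j x|)]; simp [hi]
  rw [hs, abs_of_nonneg (Finset.sum_nonneg fun i _ => abs_nonneg _)] at h
  have hEc : (0 : ℝ) < E.card := by exact_mod_cast hE.card_pos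
  have hp := hpos E.card hE.card_pos
  have hbd := (hΔ E.card).trans
    (mul_le_mul_of_nonneg_right (le_abs_self Δ) (Nat.cast_nonneg E.card))
  set y := ∑ i ∈ E, |coord i x| • e i
  rw [div_mul_eq_mul_div, div_le_iff₀ hEc]
  calc _ ≤ fundFn e (fun x => ‖x‖) E.card * (dualFundFn coord (fun x => ‖x‖) E.card * ‖y‖) := by
        gcongr
    _ = (fundFn e (fun x => ‖x‖) E.card * dualFundFn coord (fun x => ‖x‖) E.card) * ‖y‖ := by ring
    _ ≤ (|Δ| * E.card) * ‖y‖ := by gcongr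
    _ ≤ (|Δ| * E.card) * (K * ‖x‖) := by gcongr
    _ = _ := by ring

end Helpers

/-- if `X` is a Banach space with an unconditional, bidemocratic
(seminormalized Schauder) basis `(e_i)`, then for every `ε > 0` there is an equivalent
norm on `X` w.r.t. which `(e_i)` is `1`-unconditional, `1`-bidemocratic and
`(1+ε)`-greedy. -/
theorem renorming_bidemocratic_one_plus_eps_greedy
    {X : Type*} [NormedAddCommGroup X] [NormedSpace ℝ X] [CompleteSpace X]
    (e : ℕ → X) (coord : ℕ → X →L[ℝ] ℝ)
    (hbasis : IsSchauderBasis e coord)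
    (hsemi : IsSeminormalized e)
    (huncond : ∃ K : ℝ, IsUnconditionalWith e (fun x => ‖x‖) K)
    (hbidem : ∃ Δ : ℝ, IsBidemocraticWith e coord (fun x => ‖x‖) Δ)
    (ε : ℝ) (hε : 0 < ε) :
    ∃ nn : X → ℝ, IsEquivNorm nn ∧
      IsUnconditionalWith e nn 1 ∧
      IsBidemocraticWith e coord nn 1 ∧
      IsGreedyWith e coord nn (1 + ε) := by
  classical
  obtain ⟨K, hK⟩ := huncond
  obtain ⟨Δ, hΔ⟩ := hbidem
  have hK1 : 1 ≤ K := by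
    obtain ⟨c, C, hc, hcC⟩ := hsemi
    have h := hK {0} (fun _ => 1) (fun _ => 1) (fun _ => le_rfl)
    simp only [Finset.sum_singleton, one_smul] at h
    have h0 : 0 < ‖e 0‖ := hc.trans_le (hcC 0).1
    by_contra hlt
    nlinarith
  have hK0 : 0 < K := by linarith
  obtain ⟨hle, hφ0, hφpos, hφmono, hφq⟩ := hl_fund hsemi
  have hdb := hl_dual_bound hbasis hsemi hK hK0.le hΔ
  set φ := fundFn e (fun x => ‖x‖) with hφdef
  have hφnn : ∀ n, 0 ≤ φ n := fun n => hφ0 ▸ hφmono (Nat.zero_le n)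
  obtain ⟨N1, N2, N3, N4, N5⟩ := hlN_props hbasis hK
  obtain ⟨M1, M2, M3, M4⟩ := hlM_props hφnn hdb
  set N := hlN e coord with hN
  set M := hlM φ coord with hM
  have hMmono : ∀ x y, (∀ i, |coord i x| ≤ |coord i y|) → M x ≤ M y := by
    intro x y hxy
    refine ciSup_le fun E => le_trans ?_ (M4 E y)
    exact mul_le_mul_of_nonneg_left (Finset.sum_le_sum fun i _ => hxy i)
      (div_nonneg (hφnn _) (Nat.cast_nonneg _))
  obtain ⟨δ, hδ0, hδ1, hδε⟩ : ∃ δ : ℝ, 0 < δ ∧ δ * K ≤ 1 ∧ δ * K ≤ ε := by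
    refine ⟨min 1 ε / K, div_pos (lt_min one_pos hε) hK0, ?_, ?_⟩ <;>
      rw [div_mul_cancel₀ _ hK0.ne']
    · exact min_le_left _ _
    · exact min_le_right _ _
  have hmono : ∀ x y, (∀ i, |coord i x| ≤ |coord i y|) →
      max (M x) (δ * N x) ≤ max (M y) (δ * N y) := fun x y h =>
    max_le_max (hMmono x y h) (mul_le_mul_of_nonneg_left (N5 x y h) hδ0.le)
  refine ⟨fun x => max (M x) (δ * N x), ⟨?_, ?_, δ, max (|Δ| * K) (δ * K), hδ0, ?_⟩, ?_, ?_, ?_⟩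
  · intro x y
    refine max_le ?_ ?_
    · exact (M1 x y).trans (add_le_add (le_max_left _ _) (le_max_left _ _))
    · refine (mul_le_mul_of_nonneg_left (N1 x y) hδ0.le).trans ?_
      rw [mul_add]
      exact add_le_add (le_max_right _ _) (le_max_right _ _)
  · intro a x
    simp only [M2, N2]
    rw [mul_max_of_nonneg _ _ (abs_nonneg a)]
    congr 1
    ring
  · intro x
    refine ⟨(mul_le_mul_of_nonneg_left (N4 x) hδ0.le).trans (le_max_right _ _), max_le ?_ ?_⟩
    · exact (M3 x).trans (mul_le_mul_of_nonneg_right (le_max_left _ _) (norm_nonneg _))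
    · refine (mul_le_mul_of_nonneg_left (N3 x) hδ0.le).trans ?_
      rw [← mul_assoc]
      exact mul_le_mul_of_nonneg_right (le_max_right _ _) (norm_nonneg _)
  · intro s a b hab
    rw [one_mul]
    refine hmono _ _ fun i => ?_
    rw [hl_coord_sum hbasis, hl_coord_sum hbasis]
    split_ifs
    · exact hab i
    · simp
  · intro n
    rw [one_mul]
    have hM_ind : ∀ A : Finset ℕ, M (∑ i ∈ A, e i) ≤ φ A.card := by
      intro A
      refine ciSup_le fun E => ?_
      have hs : ∑ i ∈ E, |coord i (∑ j ∈ A, e j)| = ((E ∩ A).card : ℝ) := by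
        rw [Finset.sum_congr rfl (g := fun i => if i ∈ A then (1 : ℝ) else 0)
          (fun i _ => by rw [hl_coord_ind hbasis]; split_ifs <;> simp)]
        simp [Finset.sum_ite_mem]
      rw [hs]
      rcases Nat.eq_zero_or_pos E.card with hE | hE
      · simp [hE, hφnn]
      have hER : (0 : ℝ) < E.card := by exact_mod_cast hE
      have hEA1 : ((E ∩ A).card : ℝ) ≤ E.card := by
        exact_mod_cast Finset.card_le_card Finset.inter_subset_left
      have hEA2 : ((E ∩ A).card : ℝ) ≤ A.card := by
        exact_mod_cast Finset.card_le_card Finset.inter_subset_right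
      rcases le_total E.card A.card with h | h
      · calc φ E.card / E.card * ((E ∩ A).card : ℝ) ≤ φ E.card / E.card * E.card :=
              mul_le_mul_of_nonneg_left hEA1 (div_nonneg (hφnn _) hER.le)
          _ = φ E.card := div_mul_cancel₀ _ hER.ne'
          _ ≤ φ A.card := hφmono h
      · rcases Nat.eq_zero_or_pos A.card with hA | hA
        · have : A = ∅ := by simpa using hA
          simp [this, hφnn]
        have hAR : (0 : ℝ) < A.card := by exact_mod_cast hA
        calc φ E.card / E.card * ((E ∩ A).card : ℝ) ≤ φ A.card / A.card * A.card :=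
              mul_le_mul (hφq _ _ hA h) hEA2 (Nat.cast_nonneg _) (div_nonneg (hφnn _) hAR.le)
          _ = φ A.card := div_mul_cancel₀ _ hAR.ne'
    have hf : fundFn e (fun x => max (M x) (δ * N x)) n ≤ φ n := by
      refine Real.sSup_le ?_ (hφnn n)
      rintro _ ⟨A, hA, rfl⟩
      refine max_le ((hM_ind A).trans (hφmono hA)) ?_
      calc δ * N (∑ i ∈ A, e i) ≤ δ * (K * ‖∑ i ∈ A, e i‖) :=
            mul_le_mul_of_nonneg_left (N3 _) hδ0.le
        _ = δ * K * ‖∑ i ∈ A, e i‖ := by ring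
        _ ≤ 1 * ‖∑ i ∈ A, e i‖ := mul_le_mul_of_nonneg_right hδ1 (norm_nonneg _)
        _ ≤ φ n := by rw [one_mul]; exact hle A n hA
    have hd : dualFundFn coord (fun x => max (M x) (δ * N x)) n ≤ n / φ n := by
      have hq : 0 ≤ (n : ℝ) / φ n := div_nonneg (Nat.cast_nonneg _) (hφnn n)
      refine Real.sSup_le ?_ hq
      rintro _ ⟨A, hA, rfl⟩
      refine Real.sSup_le ?_ hq
      rintro _ ⟨x, hx, rfl⟩
      rcases Nat.eq_zero_or_pos A.card with hA0 | hA0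
      · have : A = ∅ := by simpa using hA0
        simpa [this] using hq
      have hAR : (0 : ℝ) < A.card := by exact_mod_cast hA0
      have hnR : (0 : ℝ) < n := by exact_mod_cast hA0.trans_le hA
      have h1 := (M4 A x).trans ((le_max_left _ _).trans hx)
      have hpn := hφpos n (hA0.trans_le hA)
      rw [le_div_iff₀ hpn]
      have h2 := Finset.abs_sum_le_sum_abs (fun i => coord i x) A
      have h3 := hφq _ _ hA0 hA
      have hS : 0 ≤ ∑ i ∈ A, |coord i x| := Finset.sum_nonneg fun i _ => abs_nonneg _
      have h4 : φ n / n * ∑ i ∈ A, |coord i x| ≤ 1 :=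
        (mul_le_mul_of_nonneg_right h3 hS).trans h1
      rw [div_mul_eq_mul_div, div_le_iff₀ hnR] at h4
      nlinarith
    have hd0 : 0 ≤ dualFundFn coord (fun x => max (M x) (δ * N x)) n := by
      refine Real.sSup_nonneg ?_
      rintro _ ⟨A, hA, rfl⟩
      refine Real.sSup_nonneg ?_
      rintro _ ⟨x, hx, rfl⟩
      exact abs_nonneg _
    calc _ ≤ φ n * (n / φ n) := mul_le_mul hf hd hd0 (hφnn n)
      _ ≤ n := by
        rcases Nat.eq_zero_or_pos n with rfl | hn
        · simp
        · exact (mul_div_cancel₀ _ (hφpos n hn).ne').le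
  · intro x m A hAm hgr
    have h1ε : 0 < 1 + ε := by linarith
    rw [← div_le_iff₀' h1ε]
    refine le_csInf ⟨_, ∅, fun _ => 0, by simp, rfl⟩ ?_
    rintro _ ⟨B, b, hB, rfl⟩
    rw [div_le_iff₀' h1ε]
    set u := x - ∑ i ∈ A, coord i x • e i with hu
    set v := x - ∑ i ∈ B, b i • e i with hv
    have hcu : ∀ j, coord j u = if j ∈ A then 0 else coord j x := by
      intro j
      rw [hu, map_sub, hl_coord_sum hbasis A (fun i => coord i x)]
      split_ifs <;> simp
    have hcv : ∀ j, j ∉ B → coord j v = coord j x := by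
      intro j hj
      rw [hv, map_sub, hl_coord_sum hbasis B b]
      simp [hj]
    have hcard : (B \ A).card ≤ (A \ B).card := by
      have h1 := Finset.card_sdiff_add_card_inter B A
      have h2 := Finset.card_sdiff_add_card_inter A B
      rw [Finset.inter_comm] at h2
      omega
    have hMuv : M u ≤ M v := by
      refine ciSup_le fun E => ?_
      obtain ⟨F, hF, hFc⟩ := Finset.exists_subset_card_eq
        (s := A \ B) (n := (E ∩ (B \ A)).card)
        ((Finset.card_le_card Finset.inter_subset_right).trans hcard)
      set G := E \ (A ∪ B) with hG
      have hdisj : Disjoint G F := by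
        rw [Finset.disjoint_left]
        intro i hi hi'
        have := hF hi'
        simp only [hG, Finset.mem_sdiff, Finset.mem_union] at hi this
        tauto
      have hdisj2 : Disjoint G (E ∩ (B \ A)) := by
        rw [Finset.disjoint_left]
        intro i hi hi'
        simp only [hG, Finset.mem_sdiff, Finset.mem_union, Finset.mem_inter] at hi hi'
        tauto
      have hsumE : ∑ i ∈ E, |coord i u| =
          ∑ i ∈ G, |coord i x| + ∑ i ∈ E ∩ (B \ A), |coord i x| := by
        rw [← Finset.sum_union hdisj2]
        have hsub : G ∪ (E ∩ (B \ A)) ⊆ E :=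
          Finset.union_subset Finset.sdiff_subset Finset.inter_subset_left
        rw [← Finset.sum_subset hsub]
        · refine Finset.sum_congr rfl fun i hi => ?_
          rw [hcu, if_neg]
          simp only [hG, Finset.mem_sdiff, Finset.mem_union, Finset.mem_inter] at hi
          tauto
        · intro i hi hi'
          rw [hcu, if_pos, abs_zero]
          simp only [hG, Finset.mem_sdiff, Finset.mem_union, Finset.mem_inter] at hi'
          tauto
      have hFle : ∑ i ∈ E ∩ (B \ A), |coord i x| ≤ ∑ i ∈ F, |coord i x| := by
        obtain ⟨σ⟩ : Nonempty ((E ∩ (B \ A) : Finset ℕ) ≃ F) :=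
          ⟨Finset.equivOfCardEq hFc.symm⟩
        rw [← Finset.sum_coe_sort (E ∩ (B \ A)), ← Finset.sum_coe_sort F, ← Equiv.sum_comp σ]
        refine Finset.sum_le_sum fun i _ => ?_
        refine hgr _ (Finset.mem_sdiff.1 (hF (σ i).2)).1 _ ?_
        have := i.2
        simp only [Finset.mem_sdiff, Finset.mem_inter] at this
        tauto
      have hsumGF : ∑ i ∈ G ∪ F, |coord i v| =
          ∑ i ∈ G, |coord i x| + ∑ i ∈ F, |coord i x| := by
        rw [← Finset.sum_union hdisj]
        refine Finset.sum_congr rfl fun i hi => ?_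
        rw [hcv]
        rcases Finset.mem_union.1 hi with h | h
        · simp only [hG, Finset.mem_sdiff, Finset.mem_union] at h
          tauto
        · exact (Finset.mem_sdiff.1 (hF h)).2
      -- enlarge `G ∪ F` to a set with the cardinality of `E`
      have hcle : (G ∪ F).card ≤ E.card := by
        rw [Finset.card_union_of_disjoint hdisj, hFc, ← Finset.card_union_of_disjoint hdisj2]
        exact Finset.card_le_card
          (Finset.union_subset Finset.sdiff_subset Finset.inter_subset_left)
      obtain ⟨H, hH, hHc⟩ := Infinite.exists_superset_card_eq (G ∪ F) E.card hcle
      refine le_trans ?_ (M4 H v)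
      rw [hHc]
      refine mul_le_mul_of_nonneg_left ?_ (div_nonneg (hφnn _) (Nat.cast_nonneg _))
      rw [hsumE]
      refine (add_le_add_right hFle _).trans ?_
      rw [← hsumGF]
      exact Finset.sum_le_sum_of_subset_of_nonneg hH fun i _ _ => abs_nonneg _
    have hMv0 : 0 ≤ M v := by simpa using M4 ∅ v
    have hδNv : 0 ≤ δ * N v := mul_nonneg hδ0.le ((norm_nonneg _).trans (N4 v))
    have hmx : 0 ≤ max (M v) (δ * N v) := le_max_of_le_left hMv0
    refine max_le ?_ ?_
    · refine hMuv.trans ((le_max_left _ _).trans (le_mul_of_one_le_left hmx (by linarith)))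
    · -- decompose `u = w + z`, where `z` lives on `B \ A`
      set z := ∑ i ∈ B \ A, coord i x • e i with hz
      have hcz : ∀ j, coord j z = if j ∈ B \ A then coord j x else 0 := fun j => by
        rw [hz, hl_coord_sum hbasis (B \ A) (fun i => coord i x)]
      have hw : N (u - z) ≤ N v := by
        refine N5 _ _ fun i => ?_
        rw [map_sub, hcu, hcz]
        by_cases hA : i ∈ A
        · simp [hA]
        · by_cases hBi : i ∈ B
          · simp [hA, hBi]
          · simp [hA, hBi, hcv]
      have hzM : δ * N z ≤ ε * M v := by
        rcases Finset.eq_empty_or_nonempty (B \ A) with hBA | hBA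
        · have : z = 0 := by rw [hz, hBA]; simp
          have hN0 : N 0 ≤ 0 := by simpa using N3 0
          rw [this]
          have := mul_nonneg hε.le hMv0
          nlinarith
        obtain ⟨j0, hj0, hmax⟩ := Finset.exists_max_image (B \ A) (fun j => |coord j x|) hBA
        set t := |coord j0 x| with ht
        have ht0 : 0 ≤ t := abs_nonneg _
        have hNz : N z ≤ t * (K * φ (B \ A).card) := by
          have h1 : N z ≤ N (t • ∑ i ∈ B \ A, e i) := by
            refine N5 _ _ fun i => ?_
            rw [hcz, map_smul, hl_coord_ind hbasis]
            split_ifs with hi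
            · simpa [abs_of_nonneg ht0] using hmax i hi
            · simp
          rw [N2, abs_of_nonneg ht0] at h1
          refine h1.trans (mul_le_mul_of_nonneg_left ?_ ht0)
          exact (N3 _).trans (mul_le_mul_of_nonneg_left (hle _ _ le_rfl) hK0.le)
        have hAB : 0 < (A \ B).card := hBA.card_pos.trans_le hcard
        have hABR : (0 : ℝ) < (A \ B).card := by exact_mod_cast hAB
        have hMt : t * φ (A \ B).card ≤ M v := by
          refine le_trans ?_ (M4 (A \ B) v)
          have h1 : (A \ B).card * t ≤ ∑ i ∈ A \ B, |coord i v| := by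
            rw [← nsmul_eq_mul]
            refine Finset.card_nsmul_le_sum _ _ _ fun i hi => ?_
            rw [Finset.mem_sdiff] at hi
            rw [hcv i hi.2]
            exact hgr i hi.1 j0 (Finset.mem_sdiff.1 hj0).2
          calc t * φ (A \ B).card = φ (A \ B).card / (A \ B).card * ((A \ B).card * t) := by
                field_simp
            _ ≤ _ := mul_le_mul_of_nonneg_left h1 (div_nonneg (hφnn _) hABR.le)
        have h2 : t * φ (B \ A).card ≤ M v :=
          (mul_le_mul_of_nonneg_left (hφmono hcard) ht0).trans hMt
        calc δ * N z ≤ δ * (t * (K * φ (B \ A).card)) := mul_le_mul_of_nonneg_left hNz hδ0.le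
          _ = (δ * K) * (t * φ (B \ A).card) := by ring
          _ ≤ ε * M v := mul_le_mul hδε h2 (mul_nonneg ht0 (hφnn _)) hε.le
      have hNu : N u ≤ N (u - z) + N z := by simpa using N1 (u - z) z
      calc δ * N u ≤ δ * (N v + N z) :=
            mul_le_mul_of_nonneg_left (hNu.trans (by linarith)) hδ0.le
        _ ≤ δ * N v + ε * M v := by rw [mul_add]; linarith
        _ ≤ max (M v) (δ * N v) + ε * max (M v) (δ * N v) :=
            add_le_add (le_max_right _ _) (mul_le_mul_of_nonneg_left (le_max_left _ _) hε.le)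
        _ = _ := by ring
end

section
/- Let (e_i) be a normalized, 1-unconditional, Δ-democratic basis of a Banach space X with fundamental function φ. Given 0 < q < 1, fix C > Δ/(q(1−q)) and set 𝒜 = { A ⊂ ℕ : A finite and ‖(φ(|A|)/|A|) Σ_{i∈A} e_i^*‖_{X*} ≤ C }. Then for every finite E ⊂ ℕ there exists A ∈ 𝒜 such that A ⊂ E and |A| ≥ q|E|. -/
open scoped BigOperators

section Helpers

variable {X : Type*} [NormedAddCommGroup X] [NormedSpace ℝ X]

lemma aux_norm_le (e : ℕ → X) (coord : ℕ → X →L[ℝ] ℝ)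
    (hbasis : IsSchauderBasis e coord)
    (huncond : IsUnconditionalWith e (fun x => ‖x‖) 1)
    (S : Finset ℕ) (c : ℕ → ℝ) (x : X) (hc : ∀ i ∈ S, |c i| ≤ |coord i x|) :
    ‖∑ i ∈ S, c i • e i‖ ≤ ‖x‖ := by
  have ht := (hbasis.expansion x).norm
  refine ge_of_tendsto ht ?_
  obtain ⟨N, hN⟩ := S.exists_nat_subset_range
  filter_upwards [Filter.eventually_ge_atTop N] with n hn
  have hsub : S ⊆ Finset.range n := hN.trans (Finset.range_mono hn)
  have h := huncond (Finset.range n) (fun i => if i ∈ S then c i else 0)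
    (fun i => coord i x) (by
      intro i
      by_cases hi : i ∈ S
      · simpa [hi] using hc i hi
      · simp [hi])
  simp only [one_mul, ite_smul, zero_smul, Finset.sum_ite_mem] at h
  rwa [Finset.inter_eq_right.mpr hsub] at h

lemma aux_dual (e : ℕ → X) (coord : ℕ → X →L[ℝ] ℝ)
    (hbasis : IsSchauderBasis e coord)
    (huncond : IsUnconditionalWith e (fun x => ‖x‖) 1)
    (F : X →L[ℝ] ℝ) (S : Finset ℕ) (w : ℕ → ℝ) (hw : ∀ i ∈ S, |w i| ≤ |F (e i)|) :
    ‖∑ i ∈ S, w i • coord i‖ ≤ ‖F‖ := by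
  refine ContinuousLinearMap.opNorm_le_bound _ (norm_nonneg _) fun x => ?_
  have h1 : (∑ i ∈ S, w i • coord i) x
      = F (∑ i ∈ S, (w i / F (e i) * coord i x) • e i) := by
    simp only [ContinuousLinearMap.sum_apply, map_sum, ContinuousLinearMap.smul_apply,
      map_smul, smul_eq_mul]
    refine Finset.sum_congr rfl fun i hi => ?_
    by_cases h0 : F (e i) = 0
    · have := hw i hi
      rw [h0, abs_zero] at this
      have h2 : w i = 0 := abs_eq_zero.mp (le_antisymm this (abs_nonneg _))
      simp [h2]
    · field_simp
  rw [h1]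
  refine (F.le_opNorm _).trans ?_
  refine mul_le_mul_of_nonneg_left ?_ (norm_nonneg _)
  refine aux_norm_le e coord hbasis huncond S _ x fun i hi => ?_
  rw [abs_mul, abs_div]
  have : |w i| / |F (e i)| ≤ 1 := div_le_one_of_le₀ (hw i hi) (abs_nonneg _)
  exact mul_le_of_le_one_left (abs_nonneg _) this

lemma aux_avg (e : ℕ → X) (m : ℕ) (M : ℝ)
    (hM : ∀ S : Finset ℕ, S.card = m → ‖∑ i ∈ S, e i‖ ≤ M) :
    ∀ (k : ℕ) (A : Finset ℕ), A.card = m + k →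
      (m : ℝ) * ‖∑ i ∈ A, e i‖ ≤ A.card * M := by
  intro k
  induction k with
  | zero =>
    intro A hA
    have hA' : A.card = m := by simpa using hA
    rw [hA']
    exact mul_le_mul_of_nonneg_left (hM A hA') (Nat.cast_nonneg _)
  | succ k ih =>
    intro A hA
    rcases Nat.eq_zero_or_pos m with h0 | hm
    · have : 0 ≤ M := (norm_nonneg _).trans (hM ∅ (by simp [h0]))
      simp only [h0, Nat.cast_zero, zero_mul]
      positivity
    have hid : ∑ j ∈ A, ∑ i ∈ A.erase j, e i = ((m + k : ℕ) : ℝ) • ∑ i ∈ A, e i := by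
      have : ∀ j ∈ A, ∑ i ∈ A.erase j, e i = (∑ i ∈ A, e i) - e j := by
        intro j hj
        rw [← Finset.sum_erase_add A e hj]; simp
      rw [Finset.sum_congr rfl this, Finset.sum_sub_distrib, Finset.sum_const, hA,
        ← Nat.cast_smul_eq_nsmul ℝ]
      push_cast
      module
    have hle : ((m + k : ℕ) : ℝ) * ‖∑ i ∈ A, e i‖ ≤ ∑ j ∈ A, ‖∑ i ∈ A.erase j, e i‖ := by
      have h := norm_sum_le A (fun j => ∑ i ∈ A.erase j, e i)
      rwa [hid, norm_smul, Real.norm_of_nonneg (Nat.cast_nonneg _)] at h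
    have h2 : (m : ℝ) * ∑ j ∈ A, ‖∑ i ∈ A.erase j, e i‖ ≤ A.card * ((m + k : ℕ) * M) := by
      rw [Finset.mul_sum, ← nsmul_eq_mul]
      refine Finset.sum_le_card_nsmul _ _ _ fun j hj => ?_
      have hc : (A.erase j).card = m + k := by rw [Finset.card_erase_of_mem hj, hA]; omega
      have := ih _ hc
      rwa [hc] at this
    have hpos : (0 : ℝ) < ((m + k : ℕ) : ℝ) := by exact_mod_cast (by omega)
    have hm0 : (0 : ℝ) ≤ m := Nat.cast_nonneg _
    have h3 := mul_le_mul_of_nonneg_left hle hm0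
    refine le_of_mul_le_mul_left ?_ hpos
    linarith

lemma aux_fund_bdd (e : ℕ → X) (hnorm : ∀ i, ‖e i‖ = 1) (n : ℕ) :
    BddAbove { r | ∃ A : Finset ℕ, A.card ≤ n ∧ r = (fun z : X => ‖z‖) (∑ i ∈ A, e i) } := by
  refine ⟨n, ?_⟩
  rintro r ⟨A, hA, rfl⟩
  refine (norm_sum_le _ _).trans ?_
  simpa [hnorm] using hA

lemma aux_fund_mono (e : ℕ → X) (hnorm : ∀ i, ‖e i‖ = 1) {k n : ℕ} (h : k ≤ n) :
    fundFn e (fun z => ‖z‖) k ≤ fundFn e (fun z => ‖z‖) n := by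
  refine csSup_le_csSup (aux_fund_bdd e hnorm n) ⟨_, ∅, by simp, rfl⟩ ?_
  rintro r ⟨A, hA, rfl⟩
  exact ⟨A, hA.trans h, rfl⟩

lemma aux_fund_pos (e : ℕ → X) (hnorm : ∀ i, ‖e i‖ = 1) {n : ℕ} (h : 1 ≤ n) :
    1 ≤ fundFn e (fun z => ‖z‖) n :=
  le_csSup (aux_fund_bdd e hnorm n) ⟨{0}, by simpa using h, by simp [hnorm]⟩

lemma aux_lower (e : ℕ → X) (Δ : ℝ) (hΔ : 1 ≤ Δ)
    (hdem : IsDemocraticWith e (fun x => ‖x‖) Δ) (B : Finset ℕ) (n : ℕ)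
    (hBn : B.card ≤ n) (hn : 1 ≤ n) :
    (B.card : ℝ) * fundFn e (fun z => ‖z‖) n ≤ n * (Δ * ‖∑ i ∈ B, e i‖) := by
  have hM : 0 ≤ Δ * ‖∑ i ∈ B, e i‖ := by positivity
  rcases Nat.eq_zero_or_pos B.card with h0 | hB
  · rw [h0]; simp only [Nat.cast_zero, zero_mul]; positivity
  have hB' : (0 : ℝ) < B.card := by exact_mod_cast hB
  rw [mul_comm, ← le_div_iff₀ hB']
  refine csSup_le ⟨_, ∅, by simp, rfl⟩ ?_
  rintro r ⟨A, hA, rfl⟩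
  rw [le_div_iff₀ hB', mul_comm]
  have hBn' : (B.card : ℝ) ≤ n := by exact_mod_cast hBn
  have hA' : (A.card : ℝ) ≤ n := by exact_mod_cast hA
  rcases le_total A.card B.card with h | h
  · exact mul_le_mul hBn' (hdem A B h) (norm_nonneg _) (Nat.cast_nonneg _)
  · obtain ⟨k, hk⟩ := Nat.exists_eq_add_of_le h
    have := aux_avg e B.card _ (fun S hS => hdem S B hS.le) k A hk
    exact this.trans (mul_le_mul_of_nonneg_right hA' hM)

lemma aux_norming (e : ℕ → X) (coord : ℕ → X →L[ℝ] ℝ)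
    (hbasis : IsSchauderBasis e coord) (hnorm : ∀ i, ‖e i‖ = 1)
    (huncond : IsUnconditionalWith e (fun x => ‖x‖) 1) (B : Finset ℕ) :
    ∃ f : X →L[ℝ] ℝ, ‖f‖ ≤ 1 ∧ (∀ i, 0 ≤ f (e i) ∧ f (e i) ≤ 1) ∧
      (∀ i ∉ B, f (e i) = 0) ∧ ‖∑ i ∈ B, e i‖ ≤ ∑ i ∈ B, f (e i) := by
  obtain ⟨g, hg1, hg2⟩ := exists_dual_vector'' ℝ (∑ i ∈ B, e i)
  have hval : ∀ j, (∑ i ∈ B, |g (e i)| • coord i) (e j) = if j ∈ B then |g (e j)| else 0 := by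
    intro j
    simp [ContinuousLinearMap.sum_apply, hbasis.biorth]
  have hge : ∀ j, |g (e j)| ≤ 1 := by
    intro j
    have := g.le_opNorm (e j)
    rw [hnorm, mul_one, Real.norm_eq_abs] at this
    exact this.trans hg1
  refine ⟨∑ i ∈ B, |g (e i)| • coord i, ?_, ?_, ?_, ?_⟩
  · exact (aux_dual e coord hbasis huncond g B _ (fun i _ => by simp)).trans hg1
  · intro i
    rw [hval]
    split_ifs
    · exact ⟨abs_nonneg _, hge i⟩
    · exact ⟨le_rfl, zero_le_one⟩
  · intro i hi
    rw [hval, if_neg hi]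
  · have : ‖∑ i ∈ B, e i‖ = ∑ i ∈ B, g (e i) := by
      rw [← map_sum]; simpa using hg2.symm
    rw [this]
    refine Finset.sum_le_sum fun i hi => ?_
    rw [hval, if_pos hi]
    exact le_abs_self _

lemma aux_iter (e : ℕ → X) (coord : ℕ → X →L[ℝ] ℝ)
    (hbasis : IsSchauderBasis e coord) (hnorm : ∀ i, ‖e i‖ = 1)
    (huncond : IsUnconditionalWith e (fun x => ‖x‖) 1) (E : Finset ℕ)
    (q c T : ℝ) (hT : 0 < T)
    (hB : ∀ B ⊆ E, (1 - q) * E.card ≤ B.card → c ≤ ‖∑ i ∈ B, e i‖) (N : ℕ) :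
    (∃ (k : ℕ) (F : X →L[ℝ] ℝ) (A : Finset ℕ), A ⊆ E ∧ q * E.card ≤ A.card ∧
      (∀ i ∈ A, T ≤ F (e i)) ∧ ‖F‖ ≤ k ∧ k * c ≤ E.card * (T + 1)) ∨
    ∃ F : X →L[ℝ] ℝ, ‖F‖ ≤ N ∧ (∀ i ∈ E, F (e i) ≤ T + 1) ∧
      N * c ≤ ∑ i ∈ E, F (e i) := by
  classical
  induction N with
  | zero =>
    right
    refine ⟨0, by simp, ?_, by simp⟩
    intro i _
    simp; linarith
  | succ N ih =>
    rcases ih with h | ⟨F, hF1, hF2, hF3⟩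
    · exact Or.inl h
    have hcard := Finset.card_filter_add_card_filter_not (s := E) (fun i => T ≤ F (e i))
    by_cases hq : q * E.card ≤ ((E.filter fun i => T ≤ F (e i)).card : ℝ)
    · left
      refine ⟨N, F, _, Finset.filter_subset _ _, hq, fun i hi => (Finset.mem_filter.mp hi).2,
        hF1, hF3.trans ?_⟩
      rw [← nsmul_eq_mul]
      exact Finset.sum_le_card_nsmul _ _ _ hF2
    right
    set B := E.filter fun i => ¬ T ≤ F (e i) with hBdef
    have hBE : B ⊆ E := Finset.filter_subset _ _
    have hcard' : ((E.filter fun i => T ≤ F (e i)).card : ℝ) + B.card = E.card := by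
      exact_mod_cast hcard
    have hcB := hB B hBE (by linarith)
    obtain ⟨f, hf1, hf2, hf3, hf4⟩ := aux_norming e coord hbasis hnorm huncond B
    refine ⟨F + f, ?_, ?_, ?_⟩
    · push_cast
      exact (norm_add_le _ _).trans (add_le_add hF1 hf1)
    · intro i hi
      rw [ContinuousLinearMap.add_apply]
      by_cases hiB : i ∈ B
      · have h1 := (Finset.mem_filter.mp hiB).2
        have h2 := (hf2 i).2
        linarith
      · rw [hf3 i hiB, add_zero]
        exact hF2 i hi
    · simp only [ContinuousLinearMap.add_apply, Finset.sum_add_distrib]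
      have : ∑ i ∈ B, f (e i) ≤ ∑ i ∈ E, f (e i) :=
        Finset.sum_le_sum_of_subset_of_nonneg hBE fun i _ _ => (hf2 i).1
      push_cast
      linarith

end Helpers

/-- let `(e_i)` be a normalized, `1`-unconditional, `Δ`-democratic
Schauder basis of a Banach space `X` with fundamental function `φ`, let `0 < q < 1` and
`C > Δ/(q(1-q))`. Then every finite `E ⊂ ℕ` has a subset `A` with `|A| ≥ q|E|` lying in
the family `𝒜 = {A : ‖(φ(|A|)/|A|) Σ_{i∈A} e_i^*‖_{X*} ≤ C}`. -/
theorem flat_norming_functional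
    {X : Type*} [NormedAddCommGroup X] [NormedSpace ℝ X] [CompleteSpace X]
    (e : ℕ → X) (coord : ℕ → X →L[ℝ] ℝ) (Δ : ℝ) (hΔ : 1 ≤ Δ)
    (hbasis : IsSchauderBasis e coord)
    (hnorm : ∀ i, ‖e i‖ = 1)
    (huncond : IsUnconditionalWith e (fun x => ‖x‖) 1)
    (hdem : IsDemocraticWith e (fun x => ‖x‖) Δ)
    (q C : ℝ) (hq0 : 0 < q) (hq1 : q < 1) (hC : Δ / (q * (1 - q)) < C) :
    ∀ E : Finset ℕ, ∃ A : Finset ℕ, A ⊆ E ∧ q * E.card ≤ A.card ∧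
      ‖(fundFn e (fun z => ‖z‖) A.card / (A.card : ℝ)) • ∑ i ∈ A, coord i‖ ≤ C := by
  intro E
  have hqq : 0 < q * (1 - q) := mul_pos hq0 (by linarith)
  have hD : 0 < Δ / (q * (1 - q)) := div_pos (by linarith) hqq
  rcases Nat.eq_zero_or_pos E.card with h0 | hE
  · refine ⟨∅, by simp, by simp [h0], ?_⟩
    simp; linarith
  have hE' : (0 : ℝ) < E.card := by exact_mod_cast hE
  obtain ⟨D, hDdef⟩ : ∃ D, D = Δ / (q * (1 - q)) := ⟨_, rfl⟩
  rw [← hDdef] at hC hD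
  have hDeq : Δ = D * (q * (1 - q)) := by 
    rw [hDdef, div_mul_cancel₀ _ hqq.ne']
  obtain ⟨T, hTdef⟩ : ∃ T, T = D / (C - D) := ⟨_, rfl⟩
  have hCD : 0 < C - D := by linarith
  have hT : 0 < T := by rw [hTdef]; positivity
  have hTeq : (T + 1) * D = C * T := by
    have : T * (C - D) = D := by rw [hTdef]; field_simp
    linarith
  obtain ⟨P, hP⟩ : ∃ P, P = fundFn e (fun z => ‖z‖) E.card := ⟨_, rfl⟩
  have hP1 : 1 ≤ P := hP ▸ aux_fund_pos e hnorm hE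
  have hΔ0 : 0 < Δ := by linarith
  have hq1' : 0 < 1 - q := by linarith
  obtain ⟨c, hc⟩ : ∃ c, c = (1 - q) * P / Δ := ⟨_, rfl⟩
  have hcpos : 0 < c := by rw [hc]; positivity
  have hB : ∀ B ⊆ E, (1 - q) * E.card ≤ B.card → c ≤ ‖∑ i ∈ B, e i‖ := by
    intro B hBE hBc
    have h := aux_lower e Δ hΔ hdem B E.card (Finset.card_le_card hBE) hE
    rw [← hP] at h
    rw [hc, div_le_iff₀ hΔ0]
    have h2 : (1 - q) * E.card * P ≤ B.card * P :=
      mul_le_mul_of_nonneg_right hBc (by linarith)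
    refine le_of_mul_le_mul_left ?_ hE'
    linarith
  obtain ⟨N, hN⟩ := exists_nat_gt (E.card * (T + 1) / c)
  rw [div_lt_iff₀ hcpos] at hN
  rcases aux_iter e coord hbasis hnorm huncond E q c T hT hB N with h | ⟨F, -, hF2, hF3⟩
  swap
  · exfalso
    have := Finset.sum_le_card_nsmul E (fun i => F (e i)) _ hF2
    rw [nsmul_eq_mul] at this
    linarith
  obtain ⟨k, F, A, hAE, hqA, hFA, hFk, hk⟩ := h
  refine ⟨A, hAE, hqA, ?_⟩
  have hApos : (0 : ℝ) < A.card := lt_of_lt_of_le (mul_pos hq0 hE') hqA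
  have hA1 : 1 ≤ A.card := by exact_mod_cast hApos
  have hφ := aux_fund_mono e hnorm (Finset.card_le_card hAE)
  have hφ1 := aux_fund_pos e hnorm hA1
  rw [← hP] at hφ
  have hdual := aux_dual e coord hbasis huncond F A (fun _ => T) (by
    intro i hi
    rw [abs_of_pos hT]
    exact (hFA i hi).trans (le_abs_self _))
  rw [← Finset.smul_sum, norm_smul, Real.norm_eq_abs, abs_of_pos hT] at hdual
  rw [norm_smul, Real.norm_eq_abs, abs_of_nonneg (div_nonneg (by linarith) hApos.le), div_mul_eq_mul_div,
    div_le_iff₀ hApos]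
  obtain ⟨S, hS⟩ : ∃ S, S = ‖∑ i ∈ A, coord i‖ := ⟨_, rfl⟩
  rw [← hS] at hdual ⊢
  have hS0 : 0 ≤ S := hS ▸ norm_nonneg _
  have h1 : fundFn e (fun z => ‖z‖) A.card * S ≤ P * S := mul_le_mul_of_nonneg_right hφ hS0
  refine h1.trans ?_
  -- `T S c ≤ |E| (T+1)`
  have h2 : T * S * c ≤ E.card * (T + 1) :=
    (mul_le_mul_of_nonneg_right (hdual.trans hFk) hcpos.le).trans hk
  have hcD : c * (D * q) = P := by
    rw [hc, hDeq]; field_simp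
  have hDq : 0 < D * q := by positivity
  have h3 := mul_le_mul_of_nonneg_right h2 hDq.le
  have h4 : T * (P * S) ≤ T * (C * A.card) := by
    calc T * (P * S) = T * S * c * (D * q) := by rw [← hcD]; ring
      _ ≤ E.card * (T + 1) * (D * q) := h3
      _ = ((T + 1) * D) * (q * E.card) := by ring
      _ = (C * T) * (q * E.card) := by rw [hTeq]
      _ ≤ (C * T) * A.card := mul_le_mul_of_nonneg_left hqA (by
          have : 0 < C := by linarith
          positivity)
      _ = _ := by ring
  exact le_of_mul_le_mul_left h4 hT
end

section
/- Let (e_i) be a greedy Schauder basis of a Banach space X. Then for every ε > 0 there is an equivalent norm on X with respect to which (e_i) is 1-unconditional and (2+ε)-greedy. -/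
open scoped BigOperators

section Helpers

variable {X : Type*} [NormedAddCommGroup X] [NormedSpace ℝ X]

/-- Lattice norm: a norm on `X`, monotone in the moduli of the coordinates. -/
structure LatNorm (coord : ℕ → X →L[ℝ] ℝ) (N : X → ℝ) : Prop where
  nonneg : ∀ x, 0 ≤ N x
  add : ∀ x y, N (x + y) ≤ N x + N y
  smul_le : ∀ (c : ℝ) x, N (c • x) ≤ |c| * N x
  mono : ∀ x y, (∀ i, |coord i x| ≤ |coord i y|) → N x ≤ N y

lemma homog_of_le {N : X → ℝ} (h0 : ∀ x, 0 ≤ N x)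
    (h : ∀ (c : ℝ) x, N (c • x) ≤ |c| * N x) (c : ℝ) (x : X) : N (c • x) = |c| * N x := by
  refine le_antisymm (h c x) ?_
  by_cases hc : c = 0
  · subst hc; simpa using h0 0
  · have h1 := h c⁻¹ (c • x)
    rw [smul_smul, inv_mul_cancel₀ hc, one_smul, abs_inv] at h1
    have hc' : 0 < |c| := abs_pos.mpr hc
    calc |c| * N x ≤ |c| * (|c|⁻¹ * N (c • x)) := by gcongr
      _ = N (c • x) := by field_simp

lemma coord_sum {e : ℕ → X} {coord : ℕ → X →L[ℝ] ℝ} (hb : IsSchauderBasis e coord)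
    (s : Finset ℕ) (a : ℕ → ℝ) (j : ℕ) :
    coord j (∑ i ∈ s, a i • e i) = if j ∈ s then a j else 0 := by
  simp [map_sum, hb.biorth]

lemma coord_sum_one {e : ℕ → X} {coord : ℕ → X →L[ℝ] ℝ} (hb : IsSchauderBasis e coord)
    (s : Finset ℕ) (j : ℕ) :
    coord j (∑ i ∈ s, e i) = if j ∈ s then 1 else 0 := by
  simpa using coord_sum hb s (fun _ => 1) j

lemma LatNorm.zero {coord : ℕ → X →L[ℝ] ℝ} {N : X → ℝ} (h : LatNorm coord N) : N 0 = 0 := by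
  have := h.smul_le 0 0
  simp at this
  exact le_antisymm this (h.nonneg 0)

lemma LatNorm.sum_le {coord : ℕ → X →L[ℝ] ℝ} {N : X → ℝ} (h : LatNorm coord N)
    (s : Finset ℕ) (f : ℕ → X) : N (∑ i ∈ s, f i) ≤ ∑ i ∈ s, N (f i) := by
  induction s using Finset.induction_on with
  | empty => simp [h.zero]
  | insert a s ha ih =>
    rw [Finset.sum_insert ha, Finset.sum_insert ha]
    exact (h.add _ _).trans (by linarith)

/-! ### Greedy implies unconditional and democratic -/

lemma bestApprox_le {e : ℕ → X} {N : X → ℝ} (h0 : ∀ x, 0 ≤ N x) (m : ℕ) (x : X)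
    (A : Finset ℕ) (a : ℕ → ℝ) (hA : A.card ≤ m) :
    bestApprox e N m x ≤ N (x - ∑ i ∈ A, a i • e i) := by
  apply csInf_le
  · exact ⟨0, by rintro r ⟨A, a, -, rfl⟩; exact h0 _⟩
  · exact ⟨A, a, hA, rfl⟩

lemma greedy_nonneg_const {e : ℕ → X} {coord : ℕ → X →L[ℝ] ℝ}
    (hg : ∃ C : ℝ, IsGreedyWith e coord (fun x => ‖x‖) C) :
    ∃ C : ℝ, 0 ≤ C ∧ ∀ (x : X) (A : Finset ℕ), GreedySet coord x A →
      ∀ (B : Finset ℕ) (a : ℕ → ℝ), B.card ≤ A.card →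
      ‖x - ∑ i ∈ A, coord i x • e i‖ ≤ C * ‖x - ∑ i ∈ B, a i • e i‖ := by
  obtain ⟨C, hC⟩ := hg
  refine ⟨max C 0, le_max_right _ _, fun x A hA B a hB => ?_⟩
  have h1 := hC x A.card A rfl hA
  have h2 := bestApprox_le (e := e) (N := fun x => ‖x‖) (fun x => norm_nonneg x) A.card x B a hB
  have h3 : 0 ≤ bestApprox e (fun x => ‖x‖) A.card x := by
    apply Real.sInf_nonneg
    rintro r ⟨A, a, -, rfl⟩
    exact norm_nonneg _
  calc _ ≤ C * bestApprox e (fun x => ‖x‖) A.card x := h1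
    _ ≤ max C 0 * bestApprox e (fun x => ‖x‖) A.card x := by gcongr; exact le_max_left _ _
    _ ≤ _ := by gcongr

lemma suppression_fin {e : ℕ → X} {coord : ℕ → X →L[ℝ] ℝ} (hb : IsSchauderBasis e coord)
    {C : ℝ} (hg : ∀ (x : X) (A : Finset ℕ), GreedySet coord x A →
      ∀ (B : Finset ℕ) (a : ℕ → ℝ), B.card ≤ A.card →
      ‖x - ∑ i ∈ A, coord i x • e i‖ ≤ C * ‖x - ∑ i ∈ B, a i • e i‖)
    (s A : Finset ℕ) (hA : A ⊆ s) (a : ℕ → ℝ) :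
    ‖∑ i ∈ A, a i • e i‖ ≤ C * ‖∑ i ∈ s, a i • e i‖ := by
  classical
  set M : ℝ := ∑ i ∈ s, |a i| with hM
  have hM0 : 0 ≤ M := Finset.sum_nonneg (fun i _ => abs_nonneg _)
  have haM : ∀ i ∈ s, |a i| ≤ M := fun i hi =>
    Finset.single_le_sum (f := fun i => |a i|) (fun i _ => abs_nonneg _) hi
  set b : ℕ → ℝ := fun i => if i ∈ A then a i else M with hbdef
  set y : X := ∑ i ∈ s, b i • e i with hy
  have hcy : ∀ j, coord j y = if j ∈ s then b j else 0 := fun j => coord_sum hb s b j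
  have hgs : GreedySet coord y (s \ A) := by
    intro i hi j hj
    simp only [Finset.mem_sdiff] at hi hj
    rw [hcy, hcy, if_pos hi.1]
    simp only [hbdef, if_neg hi.2]
    rw [abs_of_nonneg hM0]
    split_ifs with h1 h2
    · exact haM j h1
    · exact absurd ⟨h1, h2⟩ hj
    · simpa using hM0
  have key := hg y (s \ A) hgs (s \ A) (fun i => M - a i) le_rfl
  have hsplit : ∀ c : ℕ → ℝ, ∑ i ∈ s, c i • e i
      = ∑ i ∈ s \ A, c i • e i + ∑ i ∈ A, c i • e i :=
    fun c => (Finset.sum_sdiff hA).symm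
  have e1 : y - ∑ i ∈ s \ A, coord i y • e i = ∑ i ∈ A, a i • e i := by
    have : ∑ i ∈ s \ A, coord i y • e i = ∑ i ∈ s \ A, b i • e i := by
      apply Finset.sum_congr rfl
      intro i hi
      rw [hcy, if_pos (Finset.mem_sdiff.1 hi).1]
    rw [this, hy, hsplit b, add_sub_cancel_left]
    apply Finset.sum_congr rfl
    intro i hi
    simp [hbdef, hi]
  have e2 : y - ∑ i ∈ s \ A, (M - a i) • e i = ∑ i ∈ s, a i • e i := by
    rw [hy, hsplit b, hsplit a, add_sub_right_comm, ← Finset.sum_sub_distrib]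
    congr 1
    · apply Finset.sum_congr rfl
      intro i hi
      rw [← sub_smul]
      simp [hbdef, (Finset.mem_sdiff.1 hi).2]
    · apply Finset.sum_congr rfl
      intro i hi
      simp [hbdef, hi]
  rw [e1, e2] at key
  exact key

lemma suppression_all {e : ℕ → X} {coord : ℕ → X →L[ℝ] ℝ} (hb : IsSchauderBasis e coord)
    {C : ℝ} (hs : ∀ (s A : Finset ℕ), A ⊆ s → ∀ (a : ℕ → ℝ),
      ‖∑ i ∈ A, a i • e i‖ ≤ C * ‖∑ i ∈ s, a i • e i‖)
    (A : Finset ℕ) (x : X) :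
    ‖∑ i ∈ A, coord i x • e i‖ ≤ C * ‖x‖ := by
  refine ge_of_tendsto ((hb.expansion x).norm.const_mul C) ?_
  obtain ⟨n, hn⟩ := A.exists_nat_subset_range
  filter_upwards [Filter.eventually_ge_atTop n] with k hk
  exact hs _ _ (hn.trans (Finset.range_mono hk)) _

lemma convex_bound (e : ℕ → X) (c θ : ℕ → ℝ) (h0 : ∀ i, 0 ≤ θ i) (h1 : ∀ i, θ i ≤ 1)
    (M : ℝ) (F : Finset ℕ) : ∀ (y : X), (∀ E ⊆ F, ‖y + ∑ i ∈ E, c i • e i‖ ≤ M) →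
    ‖y + ∑ i ∈ F, (θ i * c i) • e i‖ ≤ M := by
  classical
  induction F using Finset.induction_on with
  | empty => intro y h; simpa using h ∅ (by simp)
  | insert j F hj ih =>
    intro y h
    have ha := ih y (fun E hE => h E (hE.trans (Finset.subset_insert _ _)))
    have hbb := ih (y + c j • e j) (fun E hE => by
      have := h (insert j E) (Finset.insert_subset_insert _ hE)
      rw [Finset.sum_insert (fun hh => hj (hE hh)), ← add_assoc] at this
      exact this)
    rw [Finset.sum_insert hj]
    set S := ∑ i ∈ F, (θ i * c i) • e i
    have : y + ((θ j * c j) • e j + S) = (1 - θ j) • (y + S) + θ j • (y + c j • e j + S) := by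
      module
    rw [this]
    have := h0 j
    have := h1 j
    calc _ ≤ ‖(1 - θ j) • (y + S)‖ + ‖θ j • (y + c j • e j + S)‖ := norm_add_le _ _
      _ = (1 - θ j) * ‖y + S‖ + θ j * ‖y + c j • e j + S‖ := by
        rw [norm_smul, norm_smul, Real.norm_of_nonneg (by linarith), Real.norm_of_nonneg (h0 j)]
      _ ≤ (1 - θ j) * M + θ j * M := by gcongr
      _ = M := by ring

lemma multiplier_bound (e : ℕ → X) (c θ : ℕ → ℝ) (h1 : ∀ i, |θ i| ≤ 1)
    (M : ℝ) (h : ∀ E : Finset ℕ, ‖∑ i ∈ E, c i • e i‖ ≤ M) (F : Finset ℕ) :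
    ‖∑ i ∈ F, (θ i * c i) • e i‖ ≤ 2 * M := by
  have hp := convex_bound e c (fun i => max (θ i) 0) (fun i => le_max_right _ _)
    (fun i => max_le (abs_le.1 (h1 i)).2 zero_le_one) M F 0 (fun E _ => by simpa using h E)
  have hm := convex_bound e c (fun i => max (-θ i) 0) (fun i => le_max_right _ _)
    (fun i => max_le (by linarith [(abs_le.1 (h1 i)).1]) zero_le_one) M F 0
    (fun E _ => by simpa using h E)
  rw [zero_add] at hp hm
  have : ∑ i ∈ F, (θ i * c i) • e i = ∑ i ∈ F, (max (θ i) 0 * c i) • e i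
      - ∑ i ∈ F, (max (-θ i) 0 * c i) • e i := by
    rw [← Finset.sum_sub_distrib]
    apply Finset.sum_congr rfl
    intro i _
    rw [← sub_smul, ← sub_mul]
    congr 2
    rcases le_total (θ i) 0 with h | h
    · rw [max_eq_right h, max_eq_left (by linarith)]; ring
    · rw [max_eq_left h, max_eq_right (by linarith)]; ring
  rw [this]
  exact (norm_sub_le _ _).trans (by linarith)

lemma democratic_of_greedy {e : ℕ → X} {coord : ℕ → X →L[ℝ] ℝ} (hb : IsSchauderBasis e coord)
    {C : ℝ} (hC : 0 ≤ C) (hg : ∀ (x : X) (A : Finset ℕ), GreedySet coord x A →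
      ∀ (B : Finset ℕ) (a : ℕ → ℝ), B.card ≤ A.card →
      ‖x - ∑ i ∈ A, coord i x • e i‖ ≤ C * ‖x - ∑ i ∈ B, a i • e i‖)
    (A B : Finset ℕ) (hAB : A.card ≤ B.card) :
    ‖∑ i ∈ A, e i‖ ≤ C * C * ‖∑ i ∈ B, e i‖ := by
  classical
  have disj : ∀ A B : Finset ℕ, Disjoint A B → A.card ≤ B.card →
      ‖∑ i ∈ A, e i‖ ≤ C * ‖∑ i ∈ B, e i‖ := by
    intro A B hd hc
    have hco : ∀ j, coord j (∑ i ∈ A ∪ B, e i) = if j ∈ A ∪ B then 1 else 0 :=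
      coord_sum_one hb _
    have := hg (∑ i ∈ A ∪ B, e i) B (by
      intro i hi j hj
      rw [hco, hco, if_pos (Finset.mem_union_right _ hi)]
      split_ifs <;> simp) A (fun _ => 1) hc
    have e1 : ∑ i ∈ B, coord i (∑ i ∈ A ∪ B, e i) • e i = ∑ i ∈ B, e i := by
      apply Finset.sum_congr rfl
      intro i hi
      rw [hco, if_pos (Finset.mem_union_right _ hi), one_smul]
    rw [e1, Finset.sum_union hd] at this
    simpa using this
  obtain ⟨D, hD1, hD2⟩ := Infinite.exists_superset_card_eq (A ∪ B) ((A ∪ B).card + A.card)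
    (Nat.le_add_right _ _)
  have hDc : (D \ (A ∪ B)).card = A.card := by
    rw [Finset.card_sdiff_of_subset hD1]; omega
  have dA : Disjoint A (D \ (A ∪ B)) :=
    Finset.disjoint_sdiff.mono_left Finset.subset_union_left
  have dB : Disjoint (D \ (A ∪ B)) B :=
    (Finset.disjoint_sdiff.mono_left Finset.subset_union_right).symm
  have h1 := disj _ _ dA hDc.ge
  have h2 := disj _ _ dB (hDc.le.trans hAB)
  calc _ ≤ _ := h1
    _ ≤ C * (C * ‖∑ i ∈ B, e i‖) := by gcongr
    _ = _ := by ring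

/-- Step one: a lattice renorming. -/
lemma exists_latNorm {e : ℕ → X} {coord : ℕ → X →L[ℝ] ℝ} (hb : IsSchauderBasis e coord)
    {C : ℝ} (hs : ∀ (A : Finset ℕ) (x : X), ‖∑ i ∈ A, coord i x • e i‖ ≤ C * ‖x‖) :
    ∃ N : X → ℝ, LatNorm coord N ∧ ∀ x, ‖x‖ ≤ N x ∧ N x ≤ 2 * C * ‖x‖ := by
  set I := Finset ℕ × {θ : ℕ → ℝ // ∀ i, |θ i| ≤ 1}
  set T : I → X → X := fun p x => ∑ i ∈ p.1, (p.2.1 i * coord i x) • e i with hT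
  have hbd : ∀ p x, ‖T p x‖ ≤ 2 * C * ‖x‖ := fun p x => by
    have := multiplier_bound e (fun i => coord i x) p.2.1 p.2.2 (C * ‖x‖) (fun E => hs E x) p.1
    simp only [hT]; linarith
  have hba : ∀ x, BddAbove (Set.range fun p => ‖T p x‖) := fun x =>
    ⟨_, by rintro _ ⟨p, rfl⟩; exact hbd p x⟩
  have hone : ∀ i : ℕ, |(fun _ : ℕ => (1:ℝ)) i| ≤ 1 := by simp
  haveI : Nonempty I := ⟨(∅, ⟨fun _ => 1, hone⟩)⟩
  refine ⟨fun x => ⨆ p, ‖T p x‖, ⟨?_, ?_, ?_, ?_⟩, fun x => ⟨?_, ?_⟩⟩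
  · exact fun x => Real.iSup_nonneg (fun p => norm_nonneg _)
  · intro x y
    apply ciSup_le
    intro p
    have : T p (x + y) = T p x + T p y := by
      simp only [hT, ← Finset.sum_add_distrib]
      apply Finset.sum_congr rfl
      intro i _
      rw [map_add]; module
    rw [this]
    exact (norm_add_le _ _).trans (add_le_add (le_ciSup (hba x) p) (le_ciSup (hba y) p))
  · intro c x
    apply ciSup_le
    intro p
    have : T p (c • x) = c • T p x := by
      simp only [hT, Finset.smul_sum]
      apply Finset.sum_congr rfl
      intro i _
      rw [map_smul, smul_eq_mul]; module
    rw [this, norm_smul, Real.norm_eq_abs]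
    exact mul_le_mul_of_nonneg_left (le_ciSup (hba x) p) (abs_nonneg _)
  · intro x y hxy
    apply ciSup_le
    rintro ⟨F, θ, hθ⟩
    have hle : ∀ i, |θ i * (coord i x / coord i y)| ≤ 1 := by
      intro i
      rw [abs_mul, abs_div]
      exact mul_le_one₀ (hθ i) (by positivity) (div_le_one_of_le₀ (hxy i) (abs_nonneg _))
    refine le_trans (le_of_eq ?_) (le_ciSup (hba y) (F, ⟨fun i => θ i * (coord i x / coord i y), hle⟩))
    simp only [hT]
    congr 1
    apply Finset.sum_congr rfl
    intro i _
    congr 1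
    by_cases h : coord i y = 0
    · have := hxy i
      rw [h, abs_zero] at this
      have := abs_nonpos_iff.1 this
      simp [this]
    · field_simp
  · refine le_of_tendsto (hb.expansion x).norm (Filter.Eventually.of_forall fun n => ?_)
    have := le_ciSup (hba x) (Finset.range n, ⟨fun _ => 1, hone⟩)
    simpa [hT] using this
  · exact ciSup_le (fun p => hbd p x)

/-! ### The second renorming -/

/-- inf-convolution value -/
noncomputable def qval (e : ℕ → X) (coord : ℕ → X →L[ℝ] ℝ) (N : X → ℝ) (D w : ℝ)
    (A : Finset ℕ) (x : X) (a : ℕ → ℝ) : ℝ :=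
  D * N (∑ i ∈ A, a i • e i) + w * ∑ i ∈ A, |coord i x - a i|

/-- inf-convolution seminorm -/
noncomputable def qn (e : ℕ → X) (coord : ℕ → X →L[ℝ] ℝ) (N : X → ℝ) (D w : ℝ)
    (A : Finset ℕ) (x : X) : ℝ := ⨅ a : ℕ → ℝ, qval e coord N D w A x a

section q
variable {e : ℕ → X} {coord : ℕ → X →L[ℝ] ℝ} {N : X → ℝ} {D w : ℝ}

lemma qval_nonneg (hN : LatNorm coord N) (hD : 0 ≤ D) (hw : 0 ≤ w) (A : Finset ℕ) (x : X)
    (a : ℕ → ℝ) : 0 ≤ qval e coord N D w A x a :=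
  add_nonneg (mul_nonneg hD (hN.nonneg _))
    (mul_nonneg hw (Finset.sum_nonneg fun _ _ => abs_nonneg _))

lemma qn_le (hN : LatNorm coord N) (hD : 0 ≤ D) (hw : 0 ≤ w) (A : Finset ℕ) (x : X)
    (a : ℕ → ℝ) : qn e coord N D w A x ≤ qval e coord N D w A x a :=
  ciInf_le ⟨0, by rintro _ ⟨b, rfl⟩; exact qval_nonneg hN hD hw A x b⟩ a

lemma qn_lat (hb : IsSchauderBasis e coord) (hN : LatNorm coord N) (hD : 0 ≤ D) (hw : 0 ≤ w)
    (A : Finset ℕ) : LatNorm coord (qn e coord N D w A) := by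
  refine ⟨fun x => Real.iInf_nonneg (qval_nonneg hN hD hw A x), ?_, ?_, ?_⟩
  · intro x y
    refine le_ciInf_add_ciInf fun a b => (qn_le hN hD hw A _ (a + b)).trans ?_
    have h1 : N (∑ i ∈ A, (a + b) i • e i) ≤ N (∑ i ∈ A, a i • e i) + N (∑ i ∈ A, b i • e i) := by
      have : ∑ i ∈ A, (a + b) i • e i = ∑ i ∈ A, a i • e i + ∑ i ∈ A, b i • e i := by
        rw [← Finset.sum_add_distrib]
        simp [add_smul]
      rw [this]; exact hN.add _ _
    have h2 : ∑ i ∈ A, |coord i (x + y) - (a + b) i| ≤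
        ∑ i ∈ A, |coord i x - a i| + ∑ i ∈ A, |coord i y - b i| := by
      rw [← Finset.sum_add_distrib]
      apply Finset.sum_le_sum
      intro i _
      have : coord i (x + y) - (a + b) i = (coord i x - a i) + (coord i y - b i) := by
        rw [map_add, Pi.add_apply]; ring
      rw [this]; exact abs_add_le _ _
    have h3 := mul_le_mul_of_nonneg_left h1 hD
    have h4 := mul_le_mul_of_nonneg_left h2 hw
    unfold qval
    linarith
  · intro c x
    show _ ≤ |c| * (⨅ a : ℕ → ℝ, qval e coord N D w A x a)
    rw [Real.mul_iInf_of_nonneg (abs_nonneg c)]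
    apply le_ciInf
    intro a
    refine (qn_le hN hD hw A _ (c • a)).trans ?_
    have h1 : N (∑ i ∈ A, (c • a) i • e i) ≤ |c| * N (∑ i ∈ A, a i • e i) := by
      have : ∑ i ∈ A, (c • a) i • e i = c • ∑ i ∈ A, a i • e i := by
        rw [Finset.smul_sum]
        simp [mul_smul]
      rw [this]; exact hN.smul_le _ _
    have h2 : ∑ i ∈ A, |coord i (c • x) - (c • a) i| = |c| * ∑ i ∈ A, |coord i x - a i| := by
      rw [Finset.mul_sum]
      apply Finset.sum_congr rfl
      intro i _
      rw [← abs_mul, map_smul, Pi.smul_apply, smul_eq_mul, smul_eq_mul, mul_sub]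
    have h3 := mul_le_mul_of_nonneg_left h1 hD
    unfold qval
    rw [h2]
    linarith
  · intro x y hxy
    apply le_ciInf
    intro a
    have hle : ∀ i, |coord i x / coord i y| ≤ 1 := by
      intro i
      rw [abs_div]
      exact div_le_one_of_le₀ (hxy i) (abs_nonneg _)
    have hxe : ∀ i, coord i x = coord i x / coord i y * coord i y := by
      intro i
      by_cases h : coord i y = 0
      · have := hxy i
        rw [h, abs_zero] at this
        have := abs_nonpos_iff.1 this
        simp [this]
      · field_simp
    refine (qn_le hN hD hw A _ (fun i => coord i x / coord i y * a i)).trans ?_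
    have h1 : N (∑ i ∈ A, (coord i x / coord i y * a i) • e i) ≤ N (∑ i ∈ A, a i • e i) := by
      apply hN.mono
      intro i
      rw [coord_sum hb A (fun i => coord i x / coord i y * a i), coord_sum hb]
      split_ifs
      · rw [abs_mul]
        exact mul_le_of_le_one_left (abs_nonneg _) (hle i)
      · exact le_rfl
    have h2 : ∑ i ∈ A, |coord i x - coord i x / coord i y * a i| ≤ ∑ i ∈ A, |coord i y - a i| := by
      apply Finset.sum_le_sum
      intro i _
      have : coord i x - coord i x / coord i y * a i
          = coord i x / coord i y * (coord i y - a i) := by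
        rw [mul_sub, ← hxe i]
      rw [this, abs_mul]
      exact mul_le_of_le_one_left (abs_nonneg _) (hle i)
    unfold qval
    gcongr

lemma qn_le_N (hb : IsSchauderBasis e coord) (hN : LatNorm coord N) (hD : 0 ≤ D) (hw : 0 ≤ w)
    (A : Finset ℕ) (x : X) : qn e coord N D w A x ≤ D * N x := by
  refine (qn_le hN hD hw A x (fun i => coord i x)).trans ?_
  unfold qval
  simp only [sub_self, abs_zero, Finset.sum_const_zero, mul_zero, add_zero]
  gcongr
  apply hN.mono
  intro i
  rw [coord_sum hb A (fun i => coord i x)]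
  split_ifs <;> simp

lemma qn_le_w (hN : LatNorm coord N) (hD : 0 ≤ D) (hw : 0 ≤ w)
    (A : Finset ℕ) (x : X) : qn e coord N D w A x ≤ w * ∑ i ∈ A, |coord i x| := by
  refine (qn_le hN hD hw A x (fun i => 0)).trans ?_
  unfold qval
  simp [hN.zero]

end q

section fund
variable {e : ℕ → X} {coord : ℕ → X →L[ℝ] ℝ} {N : X → ℝ} {Δ : ℝ}

lemma fund_bdd (hN : LatNorm coord N) (hd : IsDemocraticWith e N Δ) (n : ℕ) :
    BddAbove { r | ∃ A : Finset ℕ, A.card ≤ n ∧ r = N (∑ i ∈ A, e i) } :=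
  ⟨Δ * N (∑ i ∈ Finset.range n, e i), by
    rintro _ ⟨A, hA, rfl⟩
    exact hd _ _ (by simpa using hA)⟩

lemma le_fund (hN : LatNorm coord N) (hd : IsDemocraticWith e N Δ) {n : ℕ} (A : Finset ℕ)
    (hA : A.card ≤ n) : N (∑ i ∈ A, e i) ≤ fundFn e N n :=
  le_csSup (fund_bdd hN hd n) ⟨A, hA, rfl⟩

lemma fund_nonneg (hN : LatNorm coord N) (n : ℕ) : 0 ≤ fundFn e N n :=
  Real.sSup_nonneg (by rintro _ ⟨A, -, rfl⟩; exact hN.nonneg _)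

lemma fund_le {n : ℕ} {M : ℝ} (h : ∀ A : Finset ℕ, A.card ≤ n → N (∑ i ∈ A, e i) ≤ M) :
    fundFn e N n ≤ M :=
  csSup_le ⟨_, ∅, by simp, rfl⟩ (by rintro _ ⟨A, hA, rfl⟩; exact h A hA)

lemma fund_mono (hN : LatNorm coord N) (hd : IsDemocraticWith e N Δ) :
    Monotone (fundFn e N) := fun _ _ h => fund_le fun A hA => le_fund hN hd A (hA.trans h)

lemma fund_step (hN : LatNorm coord N) (hd : IsDemocraticWith e N Δ) (n : ℕ) :
    (n : ℝ) * fundFn e N (n + 1) ≤ (n + 1) * fundFn e N n := by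
  classical
  rcases Nat.eq_zero_or_pos n with rfl | hn
  · simpa using fund_nonneg hN 0
  have hn' : (0 : ℝ) < n := by exact_mod_cast hn
  rw [← le_div_iff₀' hn']
  apply fund_le
  intro A hA
  rw [le_div_iff₀' hn']
  rcases Nat.lt_or_ge A.card (n + 1) with h | h
  · have h1 := le_fund hN hd A (Nat.lt_succ_iff.1 h)
    have h2 := fund_nonneg (e := e) hN n
    nlinarith
  have hc : A.card = n + 1 := le_antisymm hA h
  have e1 : (n : ℝ) • ∑ i ∈ A, e i = ∑ j ∈ A, ∑ i ∈ A.erase j, e i := by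
    have : ∀ j ∈ A, ∑ i ∈ A.erase j, e i = ∑ i ∈ A, e i - e j := fun j hj => by
      rw [← Finset.add_sum_erase A e hj]; abel
    rw [Finset.sum_congr rfl this, Finset.sum_sub_distrib, Finset.sum_const, hc, succ_nsmul,
      add_sub_cancel_right, Nat.cast_smul_eq_nsmul]
  have e2 := homog_of_le hN.nonneg hN.smul_le (n : ℝ) (∑ i ∈ A, e i)
  rw [abs_of_pos hn', e1] at e2
  rw [← e2]
  refine (hN.sum_le _ _).trans ?_
  refine (Finset.sum_le_card_nsmul A _ (fundFn e N n) fun j hj => ?_).trans ?_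
  · apply le_fund hN hd
    rw [Finset.card_erase_of_mem hj]; omega
  · rw [hc, nsmul_eq_mul]; push_cast; exact le_rfl

lemma fund_ratio (hN : LatNorm coord N) (hd : IsDemocraticWith e N Δ) {m n : ℕ} (hmn : m ≤ n) :
    (m : ℝ) * fundFn e N n ≤ n * fundFn e N m := by
  rcases Nat.eq_zero_or_pos m with rfl | hm
  · simpa using mul_nonneg (Nat.cast_nonneg n) (fund_nonneg hN 0)
  induction n, hmn using Nat.le_induction with
  | base => exact le_rfl
  | succ n hn ih =>
    have hs := fund_step hN hd n
    have hn' : (0 : ℝ) < n := by exact_mod_cast hm.trans_le hn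
    have hm' : (0 : ℝ) < m := by exact_mod_cast hm
    have h1 := mul_le_mul_of_nonneg_left hs hm'.le
    have h2 := mul_le_mul_of_nonneg_left ih (by positivity : (0 : ℝ) ≤ n + 1)
    push_cast
    have : (n : ℝ) * (m * fundFn e N (n + 1)) ≤ n * ((n + 1) * fundFn e N m) := by linarith
    exact le_of_mul_le_mul_left this hn'

/-- Lower bound. -/
lemma qn_lower (hb : IsSchauderBasis e coord) (hN : LatNorm coord N)
    (hd : IsDemocraticWith e N Δ) (hΔ : 0 < Δ) {δ : ℝ} (hδ : 0 < δ) (hδ1 : δ < 1)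
    (A : Finset ℕ) (hA : A.Nonempty) :
    (1 - δ) * fundFn e N A.card ≤
      qn e coord N (4 * Δ / δ ^ 2) (fundFn e N A.card / A.card) A (∑ i ∈ A, e i) := by
  classical
  apply le_ciInf
  intro a
  set φ := fundFn e N A.card with hφ
  have hφ0 : 0 ≤ φ := fund_nonneg hN _
  have hn : (0 : ℝ) < A.card := by exact_mod_cast hA.card_pos
  set S := A.filter (fun i => δ / 2 ≤ |a i|) with hS
  have hSA : S ⊆ A := Finset.filter_subset _ _
  unfold qval
  by_cases hcase : δ / 2 * A.card ≤ S.card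
  · have h1 : N ((δ / 2) • ∑ i ∈ S, e i) ≤ N (∑ i ∈ A, a i • e i) := by
      apply hN.mono
      intro i
      rw [map_smul, coord_sum_one hb, coord_sum hb]
      by_cases hi : i ∈ S
      · rw [if_pos hi, if_pos (hSA hi), smul_eq_mul, mul_one, abs_of_pos (by linarith)]
        exact (Finset.mem_filter.1 hi).2
      · simp [hi]
    rw [homog_of_le hN.nonneg hN.smul_le, abs_of_pos (by linarith)] at h1
    have h2 : fundFn e N S.card ≤ Δ * N (∑ i ∈ S, e i) := fund_le fun B hB => hd _ _ hB
    have h3 := fund_ratio hN hd (Finset.card_le_card hSA)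
    rw [← hφ] at h3
    have h4 : δ / 2 * φ ≤ fundFn e N S.card := by
      have : (A.card : ℝ) * (δ / 2 * φ) ≤ A.card * fundFn e N S.card := by nlinarith
      exact le_of_mul_le_mul_left this hn
    have h5 : φ ≤ 4 * Δ / δ ^ 2 * N (∑ i ∈ A, a i • e i) := by
      calc φ = 4 * Δ / δ ^ 2 * (δ / 2 * (δ / 2 * φ / Δ)) := by field_simp; ring
        _ ≤ 4 * Δ / δ ^ 2 * (δ / 2 * N (∑ i ∈ S, e i)) := by
          gcongr
          rw [div_le_iff₀' hΔ]
          linarith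
        _ ≤ _ := by gcongr
    have h6 : 0 ≤ φ / A.card * ∑ i ∈ A, |coord i (∑ i ∈ A, e i) - a i| :=
      mul_nonneg (div_nonneg hφ0 hn.le) (Finset.sum_nonneg fun _ _ => abs_nonneg _)
    nlinarith
  · push Not at hcase
    have h1 : (1 - δ) * A.card ≤ ∑ i ∈ A, |coord i (∑ i ∈ A, e i) - a i| := by
      calc (1 - δ) * A.card ≤ (A.card - S.card) * (1 - δ / 2) := by nlinarith
        _ = ∑ i ∈ A \ S, (1 - δ / 2) := by
          rw [Finset.sum_const, nsmul_eq_mul, Finset.card_sdiff_of_subset hSA,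
            Nat.cast_sub (Finset.card_le_card hSA)]
        _ ≤ ∑ i ∈ A \ S, |coord i (∑ i ∈ A, e i) - a i| := by
          apply Finset.sum_le_sum
          intro i hi
          obtain ⟨hi1, hi2⟩ := Finset.mem_sdiff.1 hi
          have : |a i| < δ / 2 := by
            by_contra hh
            exact hi2 (Finset.mem_filter.2 ⟨hi1, not_lt.1 hh⟩)
          rw [coord_sum_one hb, if_pos hi1]
          have h7 := abs_lt.1 this
          exact le_trans (by linarith) (le_abs_self _)
        _ ≤ _ := Finset.sum_le_sum_of_subset_of_nonneg Finset.sdiff_subset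
          fun _ _ _ => abs_nonneg _
    have h2 : 0 ≤ 4 * Δ / δ ^ 2 * N (∑ i ∈ A, a i • e i) :=
      mul_nonneg (by positivity) (hN.nonneg _)
    have h3 : (1 - δ) * φ ≤ φ / A.card * ∑ i ∈ A, |coord i (∑ i ∈ A, e i) - a i| := by
      calc (1 - δ) * φ = φ / A.card * ((1 - δ) * A.card) := by field_simp
        _ ≤ _ := by gcongr
    linarith

/-- Step two: a `(1+ε)`-democratic lattice renorming. -/
lemma exists_latNorm_democratic (hb : IsSchauderBasis e coord) (hN : LatNorm coord N)
    (hd : IsDemocraticWith e N Δ) (hΔ : 0 < Δ) {δ : ℝ} (hδ : 0 < δ) (hδ1 : δ < 1) :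
    ∃ (P : X → ℝ) (K : ℝ), LatNorm coord P ∧ (∀ x, N x ≤ P x ∧ P x ≤ K * N x) ∧
      ∀ A B : Finset ℕ, A.card ≤ B.card →
        (1 - δ) * P (∑ i ∈ A, e i) ≤ P (∑ i ∈ B, e i) := by
  classical
  set D : ℝ := 4 * Δ / δ ^ 2 with hDdef
  have hD : 0 ≤ D := by positivity
  set w : Finset ℕ → ℝ := fun A => fundFn e N A.card / A.card with hwdef
  have hw : ∀ A, 0 ≤ w A := fun A => div_nonneg (fund_nonneg hN _) (Nat.cast_nonneg _)
  set f : Finset ℕ → X → ℝ := fun A x => max (N x) (qn e coord N D (w A) A x) with hf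
  have hq := fun A => qn_lat hb hN hD (hw A) A
  have hfK : ∀ A x, f A x ≤ (1 + D) * N x := fun A x => by
    have h1 := qn_le_N hb hN hD (hw A) A x
    have h2 := hN.nonneg x
    have h3 := mul_nonneg hD h2
    exact max_le (by linarith) (by linarith)
  have hba : ∀ x, BddAbove (Set.range fun A => f A x) := fun x =>
    ⟨_, by rintro _ ⟨A, rfl⟩; exact hfK A x⟩
  have hup : ∀ B : Finset ℕ, ⨆ A, f A (∑ i ∈ B, e i) ≤ fundFn e N B.card := by
    intro B
    apply ciSup_le
    intro A
    apply max_le (le_fund hN hd B le_rfl)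
    refine (qn_le_w hN hD (hw A) A _).trans ?_
    have hs : ∑ i ∈ A, |coord i (∑ i ∈ B, e i)| = ((A ∩ B).card : ℝ) := by
      simp only [coord_sum_one hb]
      rw [← Finset.filter_mem_eq_inter, Finset.card_filter]
      push_cast
      apply Finset.sum_congr rfl
      intro i _
      split_ifs <;> simp
    rw [hs]
    rcases A.eq_empty_or_nonempty with rfl | hA
    · simpa using fund_nonneg hN _
    have hn : (0 : ℝ) < A.card := by exact_mod_cast hA.card_pos
    have h1 := fund_ratio hN hd (Finset.card_le_card (Finset.inter_subset_left (s₁ := A) (s₂ := B)))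
    have h2 := fund_mono hN hd (Finset.card_le_card (Finset.inter_subset_right (s₁ := A) (s₂ := B)))
    refine le_trans ?_ h2
    simp only [hwdef]
    rw [div_mul_eq_mul_div, div_le_iff₀ hn]
    linarith
  refine ⟨fun x => ⨆ A, f A x, 1 + D, ⟨?_, ?_, ?_, ?_⟩, fun x => ⟨?_, ?_⟩, ?_⟩
  · exact fun x => Real.iSup_nonneg fun A => (hN.nonneg x).trans (le_max_left _ _)
  · intro x y
    apply ciSup_le
    intro A
    refine le_trans ?_ (add_le_add (le_ciSup (hba x) A) (le_ciSup (hba y) A))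
    exact max_le ((hN.add x y).trans (add_le_add (le_max_left _ _) (le_max_left _ _)))
      (((hq A).add x y).trans (add_le_add (le_max_right _ _) (le_max_right _ _)))
  · intro c x
    apply ciSup_le
    intro A
    refine le_trans ?_ (mul_le_mul_of_nonneg_left (le_ciSup (hba x) A) (abs_nonneg c))
    exact max_le ((hN.smul_le c x).trans
        (mul_le_mul_of_nonneg_left (le_max_left _ _) (abs_nonneg c)))
      (((hq A).smul_le c x).trans
        (mul_le_mul_of_nonneg_left (le_max_right _ _) (abs_nonneg c)))
  · intro x y hxy
    apply ciSup_le
    intro A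
    exact (max_le_max (hN.mono x y hxy) ((hq A).mono x y hxy)).trans (le_ciSup (hba y) A)
  · exact (le_max_left _ _).trans (le_ciSup (hba x) ∅)
  · exact ciSup_le fun A => hfK A x
  · intro A B hAB
    have h1 : (1 - δ) * (⨆ E, f E (∑ i ∈ A, e i)) ≤ (1 - δ) * fundFn e N B.card :=
      mul_le_mul_of_nonneg_left ((hup A).trans (fund_mono hN hd hAB)) (by linarith)
    rcases B.eq_empty_or_nonempty with rfl | hB
    · have : A = ∅ := Finset.card_eq_zero.1 (by simpa using hAB)
      subst this
      have h0 : 0 ≤ ⨆ E, f E (∑ i ∈ (∅ : Finset ℕ), e i) :=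
        Real.iSup_nonneg fun A => (hN.nonneg _).trans (le_max_left _ _)
      show (1 - δ) * (⨆ E, f E (∑ i ∈ (∅ : Finset ℕ), e i)) ≤ _
      nlinarith
    · have h2 := qn_lower hb hN hd hΔ hδ hδ1 B hB
      exact h1.trans (h2.trans ((le_max_right _ _).trans (le_ciSup (hba _) B)))

/-- Final step: greedy constant of a lattice norm. -/
lemma greedy_of_democratic (hb : IsSchauderBasis e coord) {P : X → ℝ} (hP : LatNorm coord P)
    {L : ℝ} (hL : 0 ≤ L)
    (hd : ∀ A B : Finset ℕ, A.card ≤ B.card →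
        P (∑ i ∈ A, e i) ≤ L * P (∑ i ∈ B, e i)) :
    IsGreedyWith e coord P (1 + L) := by
  classical
  rintro x m A rfl hA
  rw [← div_le_iff₀' (by linarith)]
  refine le_csInf ⟨P (x - ∑ i ∈ (∅ : Finset ℕ), (0 : ℝ) • e i), ∅, fun _ => 0, by simp, rfl⟩ ?_
  rintro _ ⟨B, a, hB, rfl⟩
  rw [div_le_iff₀' (by linarith)]
  set z := x - ∑ i ∈ B, a i • e i with hz
  have hcz : ∀ j, j ∉ B → coord j z = coord j x := by
    intro j hj
    rw [hz, map_sub, coord_sum hb, if_neg hj, sub_zero]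
  have hsp : x - ∑ i ∈ A, coord i x • e i =
      (x - ∑ i ∈ A ∪ B, coord i x • e i) + ∑ i ∈ B \ A, coord i x • e i := by
    rw [← Finset.union_sdiff_self_eq_union, Finset.sum_union Finset.disjoint_sdiff]
    abel
  have h1 : P (x - ∑ i ∈ A ∪ B, coord i x • e i) ≤ P z := by
    apply hP.mono
    intro j
    rw [map_sub, coord_sum hb (A ∪ B) (fun i => coord i x)]
    by_cases hj : j ∈ A ∪ B
    · simp [hj]
    · rw [if_neg hj, sub_zero, hcz j (fun h => hj (Finset.mem_union_right _ h))]
  have hcard : (B \ A).card ≤ (A \ B).card := by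
    have e1 := Finset.card_sdiff_add_card_inter B A
    have e2 := Finset.card_sdiff_add_card_inter A B
    rw [Finset.inter_comm] at e2
    omega
  have h2 : P (∑ i ∈ B \ A, coord i x • e i) ≤ L * P z := by
    rcases (A \ B).eq_empty_or_nonempty with h | h
    · have : B \ A = ∅ := Finset.card_eq_zero.1 (by rw [h] at hcard; simpa using hcard)
      rw [this, Finset.sum_empty, hP.zero]
      exact mul_nonneg hL (hP.nonneg _)
    · obtain ⟨k, hk, hmin⟩ := Finset.exists_min_image (A \ B) (fun i => |coord i x|) h
      set t := |coord k x| with ht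
      have ht0 : 0 ≤ t := abs_nonneg _
      have h3 : P (∑ i ∈ B \ A, coord i x • e i) ≤ P (t • ∑ i ∈ B \ A, e i) := by
        apply hP.mono
        intro j
        rw [map_smul, coord_sum hb (B \ A) (fun i => coord i x), coord_sum_one hb]
        by_cases hj : j ∈ B \ A
        · rw [if_pos hj, if_pos hj, smul_eq_mul, mul_one, abs_of_nonneg ht0]
          exact hA k (Finset.mem_sdiff.1 hk).1 j (Finset.mem_sdiff.1 hj).2
        · simp [hj]
      have h4 : P (t • ∑ i ∈ A \ B, e i) ≤ P z := by
        apply hP.mono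
        intro j
        rw [map_smul, coord_sum_one hb]
        by_cases hj : j ∈ A \ B
        · rw [if_pos hj, smul_eq_mul, mul_one, abs_of_nonneg ht0,
            hcz j (Finset.mem_sdiff.1 hj).2]
          exact hmin j hj
        · simp [hj]
      rw [homog_of_le hP.nonneg hP.smul_le, abs_of_nonneg ht0] at h3 h4
      calc _ ≤ _ := h3
        _ ≤ t * (L * P (∑ i ∈ A \ B, e i)) := by gcongr; exact hd _ _ hcard
        _ = L * (t * P (∑ i ∈ A \ B, e i)) := by ring
        _ ≤ _ := by gcongr
  rw [hsp]
  refine (hP.add _ _).trans ?_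
  linarith

end fund

end Helpers

/-- if `(e_i)` is a greedy Schauder basis of a Banach space `X`, then for
every `ε > 0` there is an equivalent norm on `X` w.r.t. which `(e_i)` is
`1`-unconditional and `(2+ε)`-greedy. -/
theorem renorming_two_plus_eps_greedy
    {X : Type*} [NormedAddCommGroup X] [NormedSpace ℝ X] [CompleteSpace X]
    (e : ℕ → X) (coord : ℕ → X →L[ℝ] ℝ)
    (hbasis : IsSchauderBasis e coord)
    (hgreedy : ∃ C : ℝ, IsGreedyWith e coord (fun x => ‖x‖) C)
    (ε : ℝ) (hε : 0 < ε) :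
    ∃ nn : X → ℝ, IsEquivNorm nn ∧
      IsUnconditionalWith e nn 1 ∧
      IsGreedyWith e coord nn (2 + ε) := by
  obtain ⟨C, hC, hg⟩ := greedy_nonneg_const hgreedy
  have hs := suppression_all hbasis (C := C) (fun s A hA a => suppression_fin hbasis hg s A hA a)
  obtain ⟨N, hN, hNe⟩ := exists_latNorm hbasis hs
  have hd : IsDemocraticWith e N (2 * C * (C * C) + 1) := by
    intro A B hAB
    have h1 := democratic_of_greedy hbasis hC hg A B hAB
    calc N (∑ i ∈ A, e i) ≤ 2 * C * ‖∑ i ∈ A, e i‖ := (hNe _).2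
      _ ≤ 2 * C * (C * C * ‖∑ i ∈ B, e i‖) := by gcongr
      _ = 2 * C * (C * C) * ‖∑ i ∈ B, e i‖ := by ring
      _ ≤ (2 * C * (C * C) + 1) * N (∑ i ∈ B, e i) := by
        gcongr
        · linarith
        · exact (hNe _).1
  have hδ : 0 < ε / (1 + ε) := by positivity
  have hδ1 : ε / (1 + ε) < 1 := by rw [div_lt_one (by positivity)]; linarith
  obtain ⟨P, K, hP, hPN, hPd⟩ := exists_latNorm_democratic hbasis hN hd (by positivity) hδ hδ1
  refine ⟨P, ⟨hP.add, homog_of_le hP.nonneg hP.smul_le, 1, |K| * (2 * C), one_pos, ?_⟩, ?_, ?_⟩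
  · intro x
    refine ⟨by simpa using (hNe x).1.trans (hPN x).1, ?_⟩
    calc P x ≤ K * N x := (hPN x).2
      _ ≤ |K| * N x := mul_le_mul_of_nonneg_right (le_abs_self K) (hN.nonneg x)
      _ ≤ |K| * (2 * C * ‖x‖) := mul_le_mul_of_nonneg_left (hNe x).2 (abs_nonneg K)
      _ = _ := by ring
  · intro s a b hab
    rw [one_mul]
    apply hP.mono
    intro i
    rw [coord_sum hbasis, coord_sum hbasis]
    split_ifs
    · exact hab i
    · exact le_rfl
  · have := greedy_of_democratic hbasis hP (L := 1 + ε) (by linarith) (fun A B hAB => by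
      have h := hPd A B hAB
      have h1 : 1 - ε / (1 + ε) = (1 + ε)⁻¹ := by field_simp; ring
      rwa [h1, inv_mul_le_iff₀ (by positivity)] at h)
    have h2 : (2 : ℝ) + ε = 1 + (1 + ε) := by ring
    rw [h2]; exact this
end

section
/- Let (e_i) be a greedy Schauder basis of a Banach space X with fundamental function φ, extended to a fundamental function on [1,∞), and assume δ(φ) > 0. Then for every ε > 0 there is an equivalent norm on X with respect to which (e_i) is normalized, 1-unconditional and (1+ε)-greedy. -/
open scoped BigOperators

namespace RenormAux

open Finset Filter Topology

lemma delta_bound (φ : ℝ → ℝ) (hφ : IsFundamentalFunction φ) (hδ : 0 < deltaParam φ) :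
    ∃ d : ℝ, 0 < d ∧ ∀ y : ℝ, 1 ≤ y → ∃ x0 : ℝ, 1 ≤ x0 ∧ ∀ x, x0 ≤ x →
      d * (y * φ x) ≤ φ (y * x) := by
  obtain ⟨hpos, hmono, hdec⟩ := hφ
  have hbdd : BddBelow { d | ∃ y : ℝ, 1 ≤ y ∧ d = deltaFn φ y } := by
    by_contra h
    have := Real.sInf_of_not_bddBelow h
    unfold deltaParam at hδ
    linarith
  refine ⟨deltaParam φ / 2, by linarith, fun y hy => ?_⟩
  have h1 : deltaParam φ ≤ deltaFn φ y := csInf_le hbdd ⟨y, hy, rfl⟩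
  have h2 : deltaParam φ / 2 < deltaFn φ y := by linarith
  have hb : IsBoundedUnder (· ≥ ·) atTop (fun x : ℝ => φ (y * x) / (y * φ x)) := by
    refine ⟨0, ?_⟩
    rw [eventually_map]
    filter_upwards [eventually_ge_atTop (1 : ℝ)] with x hx
    have := hpos x hx
    have := hpos (y * x) (by nlinarith)
    positivity
  have h3 := eventually_lt_of_lt_liminf h2 hb
  obtain ⟨x0, hx0⟩ := eventually_atTop.1 h3
  refine ⟨max x0 1, le_max_right _ _, fun x hx => ?_⟩
  have h4 := hx0 x ((le_max_left _ _).trans hx)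
  have hx1 : 1 ≤ x := (le_max_right _ _).trans hx
  have := hpos x hx1
  rw [lt_div_iff₀ (by positivity)] at h4
  exact h4.le

lemma growth (φ : ℝ → ℝ) (hφ : IsFundamentalFunction φ) (hδ : 0 < deltaParam φ)
    (α : ℝ) (hα : 0 < α) :
    ∃ K : ℝ, 0 < K ∧ ∀ x y : ℝ, 1 ≤ x → x ≤ y →
      x ^ α * (φ x / x) ≤ K * (y ^ α * (φ y / y)) := by
  obtain ⟨d, hd, hdb⟩ := delta_bound φ hφ hδ
  obtain ⟨hpos, hmono, hdec⟩ := hφ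
  obtain ⟨Y, hYd, hY2⟩ := (((tendsto_rpow_atTop hα).eventually_ge_atTop (1 / d)).and
    (eventually_ge_atTop (2 : ℝ))).exists
  obtain ⟨x0, hx01, hx0⟩ := hdb Y (by linarith)
  have hY0 : 0 < Y := by linarith
  have hYd' : 1 ≤ Y ^ α * d := by
    rwa [div_le_iff₀ hd] at hYd
  set g : ℝ → ℝ := fun x => x ^ α * (φ x / x) with hg
  have gpos : ∀ x, 1 ≤ x → 0 < g x := fun x hx => by
    have := hpos x hx
    have : 0 < x := by linarith
    simp only [hg]; positivity
  have step : ∀ x, x0 ≤ x → g x ≤ g (Y * x) := by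
    intro x hx
    have hx1 : 1 ≤ x := hx01.trans hx
    have hxp : 0 < x := by linarith
    have h1 := hx0 x hx
    have h2 := hpos x hx1
    simp only [hg]
    rw [Real.mul_rpow hY0.le hxp.le]
    have h3 : d * (φ x / x) ≤ φ (Y * x) / (Y * x) := by
      rw [le_div_iff₀ (by positivity)]
      calc d * (φ x / x) * (Y * x) = d * (Y * φ x) := by field_simp
        _ ≤ _ := h1
    have hxa : 0 < x ^ α := by positivity
    have hYa : 0 < Y ^ α := by positivity
    calc x ^ α * (φ x / x) = 1 * (x ^ α * (φ x / x)) := by ring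
      _ ≤ (Y ^ α * d) * (x ^ α * (φ x / x)) := by gcongr
      _ = Y ^ α * x ^ α * (d * (φ x / x)) := by ring
      _ ≤ _ := by gcongr
  have stepk : ∀ k : ℕ, ∀ x, x0 ≤ x → g x ≤ g (Y ^ k * x) := by
    intro k
    induction k with
    | zero => intro x _; simp
    | succ k ih =>
      intro x hx
      refine (ih x hx).trans ?_
      have : x0 ≤ Y ^ k * x := by
        have : 1 ≤ Y ^ k := one_le_pow₀ (by linarith)
        nlinarith
      have h := step _ this
      rwa [← mul_assoc, ← pow_succ'] at h
  have big : ∀ x y, x0 ≤ x → x ≤ y → g x ≤ Y * g y := by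
    intro x y hx hxy
    have hxp : 0 < x := by linarith
    obtain ⟨k, hk1, hk2⟩ := exists_nat_pow_near (x := y / x) (y := Y)
      (by rw [le_div_iff₀ hxp]; linarith) (by linarith)
    rw [le_div_iff₀ hxp] at hk1
    rw [div_lt_iff₀ hxp] at hk2
    have h1 := stepk k x hx
    set z := Y ^ k * x with hz
    have hzx : x ≤ z := by
      have : 1 ≤ Y ^ k := one_le_pow₀ (by linarith)
      nlinarith
    have hz1 : 1 ≤ z := by linarith
    have hzp : 0 < z := by linarith
    have hyp : 0 < y := by linarith
    have hyz : y ≤ Y * z := by rw [hz, ← mul_assoc, ← pow_succ']; exact hk2.le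
    refine h1.trans ?_
    simp only [hg]
    have h2 := hmono z y hz1 hk1
    have h3 := hpos z hz1
    have h4 : φ z / z ≤ Y * (φ y / y) := by
      rw [div_le_iff₀ hzp]
      calc φ z ≤ φ y := h2
        _ = φ y / y * y := by field_simp
        _ ≤ φ y / y * (Y * z) := by
          have : 0 < φ y := by linarith
          gcongr
        _ = _ := by ring
    have h5 : z ^ α ≤ y ^ α := Real.rpow_le_rpow hzp.le hk1 hα.le
    calc z ^ α * (φ z / z) ≤ y ^ α * (Y * (φ y / y)) := by gcongr
      _ = _ := by ring
  set U := x0 ^ α * φ 1 with hU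
  set l := φ x0 / x0 with hl
  have hφ1 := hpos 1 le_rfl
  have hφ0 := hpos x0 hx01
  have hx0p : 0 < x0 := by linarith
  have hUp : 0 < U := by positivity
  have hlp : 0 < l := by positivity
  have gU : ∀ x, 1 ≤ x → x ≤ x0 → g x ≤ U := by
    intro x h1 h2
    have h3 := hdec 1 x le_rfl h1
    have hx : 0 < x := by linarith
    have := hpos x h1
    simp only [hg, hU]
    have h5 : x ^ α ≤ x0 ^ α := Real.rpow_le_rpow hx.le h2 hα.le
    rw [div_one] at h3
    gcongr
  have gl : ∀ x, 1 ≤ x → x ≤ x0 → l ≤ g x := by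
    intro x h1 h2
    have h3 := hdec x x0 h1 h2
    have h4 : 1 ≤ x ^ α := Real.one_le_rpow h1 hα.le
    simp only [hg]
    have : 0 < φ x / x := by have := hpos x h1; positivity
    nlinarith
  refine ⟨Y + U / l * Y + U / l, by positivity, fun x y hx hxy => ?_⟩
  change g x ≤ _ * g y
  have gy := gpos y (hx.trans hxy)
  have hUl : 0 < U / l := by positivity
  rcases le_total x0 x with h | h
  · have := big x y h hxy
    have : 0 < (U / l * Y + U / l) * g y := by positivity
    nlinarith
  · have h1 := gU x hx h
    rcases le_total x0 y with h' | h'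
    · have h2 := big x0 y le_rfl h'
      have h3 := gl x0 hx01 le_rfl
      have h4 : U ≤ U / l * (Y * g y) := by
        calc U = U / l * l := by field_simp
          _ ≤ _ := by gcongr; linarith
      have : 0 < (Y + U / l) * g y := by positivity
      nlinarith
    · have h3 := gl y (hx.trans hxy) h'
      have h4 : U ≤ U / l * g y := by
        calc U = U / l * l := by field_simp
          _ ≤ _ := by gcongr
      have : 0 < (Y + U / l * Y) * g y := by positivity
      nlinarith

lemma exists_lam (φ : ℝ → ℝ) (hφ : IsFundamentalFunction φ) (hδ : 0 < deltaParam φ)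
    (N η : ℝ) (hN : 1 ≤ N) (hη : 0 < η) :
    ∃ (lam : ℕ → ℝ) (a b : ℝ), 0 < a ∧ 0 < b ∧ lam 1 = 1 ∧ (∀ n, 1 ≤ n → 0 < lam n) ∧
      (∀ m n, 1 ≤ m → m ≤ n → lam n ≤ lam m) ∧
      (∀ m n : ℕ, 1 ≤ m → m ≤ n → lam m ≤ √((n : ℝ) / m) * lam n) ∧
      (∀ m n : ℕ, 1 ≤ m → m ≤ n → (n : ℝ) ≤ N * m → lam m ≤ (1 + η) * lam n) ∧
      (∀ n : ℕ, 1 ≤ n → a * φ n ≤ n * lam n ∧ n * lam n ≤ b * φ n) := by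
  obtain ⟨α, hα, hα2, hNα⟩ : ∃ α : ℝ, 0 < α ∧ α ≤ 1 / 2 ∧ N ^ α ≤ 1 + η := by
    have hc : Tendsto (fun t : ℝ => N ^ t) (𝓝[>] 0) (𝓝 (N ^ (0 : ℝ))) := by
      refine Tendsto.mono_left ?_ nhdsWithin_le_nhds
      exact (Real.continuous_const_rpow (by linarith)).tendsto 0
    rw [Real.rpow_zero] at hc
    have h1 := hc.eventually (eventually_le_nhds (show (1 : ℝ) < 1 + η by linarith))
    have h2 : ∀ᶠ t : ℝ in 𝓝[>] 0, t ≤ 1 / 2 :=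
      nhdsWithin_le_nhds (eventually_le_nhds (by norm_num))
    obtain ⟨t, ⟨h, h'⟩, h''⟩ := ((h1.and h2).and self_mem_nhdsWithin).exists
    exact ⟨t, h'', h', h⟩
  obtain ⟨K, hK, hgr⟩ := growth φ hφ hδ α hα
  obtain ⟨hpos, hmono, hdec⟩ := hφ
  set l0 : ℕ → ℝ := fun m => φ m / m with hl0
  have l0pos : ∀ m : ℕ, 1 ≤ m → 0 < l0 m := fun m hm => by
    have := hpos m (by exact_mod_cast hm)
    have : (0 : ℝ) < m := by exact_mod_cast hm
    simp only [hl0]; positivity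
  have l0dec : ∀ m n : ℕ, 1 ≤ m → m ≤ n → l0 n ≤ l0 m := fun m n hm hmn =>
    hdec m n (by exact_mod_cast hm) (by exact_mod_cast hmn)
  set T : ℕ → ℕ → ℝ := fun n m => l0 (m + 1) * min 1 ((((m + 1 : ℕ) : ℝ) / n) ^ α) with hT
  have Tle : ∀ n m, T n m ≤ l0 1 := by
    intro n m
    have h1 := l0dec 1 (m + 1) le_rfl (by omega)
    have h2 := l0pos (m + 1) (by omega)
    simp only [hT]
    calc _ ≤ l0 (m + 1) * 1 := by gcongr; exact min_le_left _ _
      _ ≤ _ := by linarith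
  have Tbdd : ∀ n, BddAbove (Set.range (T n)) := fun n => ⟨l0 1, by
    rintro _ ⟨m, rfl⟩; exact Tle n m⟩
  set L : ℕ → ℝ := fun n => ⨆ m, T n m with hL
  have Lge : ∀ n, 1 ≤ n → l0 n ≤ L n := by
    intro n hn
    have h := le_ciSup (Tbdd n) (n - 1)
    have hn' : (n : ℝ) ≠ 0 := by positivity
    simp only [hT] at h
    rw [Nat.sub_add_cancel hn, div_self hn', Real.one_rpow, min_self, mul_one] at h
    exact h
  have Lle : ∀ n, 1 ≤ n → L n ≤ (1 + K) * l0 n := by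
    intro n hn
    refine ciSup_le fun m => ?_
    simp only [hT]
    have hp := l0pos n hn
    have hp' := l0pos (m + 1) (by omega)
    have hn0 : (0 : ℝ) < n := by exact_mod_cast hn
    rcases le_total n (m + 1) with h | h
    · have h1 := l0dec n (m + 1) hn h
      calc _ ≤ l0 (m + 1) * 1 := by gcongr; exact min_le_left _ _
        _ ≤ _ := by nlinarith
    · have h1 := hgr ((m + 1 : ℕ) : ℝ) n (by exact_mod_cast Nat.succ_le_succ (Nat.zero_le m)) (by exact_mod_cast h)
      have hna : (0 : ℝ) < (n : ℝ) ^ α := by positivity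
      calc _ ≤ l0 (m + 1) * (((m + 1 : ℕ) : ℝ) / n) ^ α := by gcongr; exact min_le_right _ _
        _ = (((m + 1 : ℕ) : ℝ) ^ α * l0 (m + 1)) / (n : ℝ) ^ α := by
          rw [Real.div_rpow (by positivity) (by positivity)]; ring
        _ ≤ K * ((n : ℝ) ^ α * l0 n) / (n : ℝ) ^ α := by gcongr
        _ = K * l0 n := by field_simp
        _ ≤ _ := by nlinarith
  have Ldec : ∀ m n : ℕ, 1 ≤ m → m ≤ n → L n ≤ L m := by
    intro m n hm hmn
    have hm0 : (0 : ℝ) < m := by exact_mod_cast hm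
    refine ciSup_mono (Tbdd m) fun k => ?_
    have := l0pos (k + 1) (by omega)
    simp only [hT]
    gcongr
  have Linc : ∀ m n : ℕ, 1 ≤ m → m ≤ n → L m ≤ ((n : ℝ) / m) ^ α * L n := by
    intro m n hm hmn
    have hm0 : (0 : ℝ) < m := by exact_mod_cast hm
    have hmn' : (m : ℝ) ≤ n := by exact_mod_cast hmn
    have hn0 : (0 : ℝ) < n := by linarith
    refine ciSup_le fun k => ?_
    have h1 := le_ciSup (Tbdd n) k
    have hp := l0pos (k + 1) (by omega)
    have hr : 1 ≤ ((n : ℝ) / m) ^ α := Real.one_le_rpow (by rw [le_div_iff₀ hm0]; linarith) hα.le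
    refine le_trans ?_ (mul_le_mul_of_nonneg_left h1 (by linarith))
    simp only [hT]
    have : min 1 ((((k + 1 : ℕ) : ℝ) / m) ^ α) ≤
        ((n : ℝ) / m) ^ α * min 1 ((((k + 1 : ℕ) : ℝ) / n) ^ α) := by
      rw [mul_min_of_nonneg _ _ (by linarith), ← Real.mul_rpow (by positivity) (by positivity)]
      refine min_le_min (by linarith) (le_of_eq ?_)
      congr 1
      field_simp
    calc _ ≤ l0 (k + 1) * (((n : ℝ) / m) ^ α * min 1 ((((k + 1 : ℕ) : ℝ) / n) ^ α)) := by gcongr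
      _ = _ := by ring
  have L1 : L 1 = φ 1 := by
    have h : l0 1 = φ 1 := by simp [hl0]
    rw [← h]
    exact le_antisymm (ciSup_le fun m => Tle 1 m) (Lge 1 le_rfl)
  have hφ1 := hpos 1 le_rfl
  have Lpos : ∀ n, 1 ≤ n → 0 < L n := fun n hn => (l0pos n hn).trans_le (Lge n hn)
  refine ⟨fun n => L n / φ 1, 1 / φ 1, (1 + K) / φ 1, by positivity, by positivity, ?_, ?_, ?_, ?_, ?_, ?_⟩
  · simp only [L1]; field_simp
  · intro n hn; have := Lpos n hn; positivity
  · intro m n hm hmn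
    have := Ldec m n hm hmn
    dsimp only; gcongr
  · intro m n hm hmn
    have h := Linc m n hm hmn
    have hm0 : (0 : ℝ) < m := by exact_mod_cast hm
    have hmn' : (m : ℝ) ≤ n := by exact_mod_cast hmn
    have h2 : ((n : ℝ) / m) ^ α ≤ √((n : ℝ) / m) := by
      rw [Real.sqrt_eq_rpow]
      exact Real.rpow_le_rpow_of_exponent_le (by rw [le_div_iff₀ hm0]; linarith) hα2
    have := Lpos n (hm.trans hmn)
    dsimp only
    rw [← mul_div_assoc]
    refine (div_le_div_iff_of_pos_right hφ1).2 ?_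
    exact h.trans (by gcongr)
  · intro m n hm hmn hnN
    have h := Linc m n hm hmn
    have hm0 : (0 : ℝ) < m := by exact_mod_cast hm
    have h2 : ((n : ℝ) / m) ^ α ≤ 1 + η := by
      refine le_trans (Real.rpow_le_rpow (by positivity) ?_ hα.le) hNα
      rw [div_le_iff₀ hm0]; exact hnN
    have := Lpos n (hm.trans hmn)
    dsimp only
    rw [← mul_div_assoc]
    refine (div_le_div_iff_of_pos_right hφ1).2 ?_
    exact h.trans (by gcongr)
  · intro n hn
    have h1 := Lge n hn
    have h2 := Lle n hn
    have hn0 : (0 : ℝ) < n := by exact_mod_cast hn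
    have h3 : φ n = n * l0 n := by simp only [hl0]; field_simp
    rw [h3]
    dsimp only
    constructor
    · rw [← mul_div_assoc (n : ℝ) (L n), one_div, inv_mul_eq_div]
      refine (div_le_div_iff_of_pos_right hφ1).2 ?_
      gcongr
    · rw [← mul_div_assoc (n : ℝ) (L n), div_mul_eq_mul_div]
      refine (div_le_div_iff_of_pos_right hφ1).2 ?_
      nlinarith

end RenormAux

namespace RenormAux

open Finset Filter Topology

section Basis

variable {X : Type*} [NormedAddCommGroup X] [NormedSpace ℝ X]

lemma coord_sum {e : ℕ → X} {coord : ℕ → X →L[ℝ] ℝ} (hb : IsSchauderBasis e coord)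
    (s : Finset ℕ) (a : ℕ → ℝ) (j : ℕ) :
    coord j (∑ i ∈ s, a i • e i) = if j ∈ s then a j else 0 := by
  simp [map_sum, hb.biorth]

lemma coord_sum_one {e : ℕ → X} {coord : ℕ → X →L[ℝ] ℝ} (hb : IsSchauderBasis e coord)
    (s : Finset ℕ) (j : ℕ) :
    coord j (∑ i ∈ s, e i) = if j ∈ s then 1 else 0 := by
  simp [map_sum, hb.biorth]

lemma bestApprox_le (e : ℕ → X) (m : ℕ) (x : X) (A : Finset ℕ) (a : ℕ → ℝ) (hA : A.card ≤ m) :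
    bestApprox e (fun x => ‖x‖) m x ≤ ‖x - ∑ i ∈ A, a i • e i‖ := by
  refine csInf_le ⟨0, ?_⟩ ⟨A, a, hA, rfl⟩
  rintro _ ⟨A, a, _, rfl⟩
  exact norm_nonneg _

lemma greedy_bound {e : ℕ → X} {coord : ℕ → X →L[ℝ] ℝ}
    (hg : ∃ C : ℝ, IsGreedyWith e coord (fun x => ‖x‖) C) :
    ∃ C : ℝ, 1 ≤ C ∧ ∀ (x : X) (A B : Finset ℕ) (b : ℕ → ℝ), B.card ≤ A.card →
      GreedySet coord x A →
      ‖x - ∑ i ∈ A, coord i x • e i‖ ≤ C * ‖x - ∑ i ∈ B, b i • e i‖ := by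
  obtain ⟨C, hC⟩ := hg
  refine ⟨max C 1, le_max_right _ _, fun x A B b hBA hA => ?_⟩
  refine (hC x A.card A rfl hA).trans ?_
  have h0 : 0 ≤ bestApprox e (fun x => ‖x‖) A.card x := by
    refine Real.sInf_nonneg ?_
    rintro _ ⟨A, a, _, rfl⟩
    exact norm_nonneg _
  have h1 := bestApprox_le e A.card x B b hBA
  have h2 := le_max_left C 1
  have h3 := le_max_right C 1
  nlinarith

lemma suppression_fin {e : ℕ → X} {coord : ℕ → X →L[ℝ] ℝ} (hb : IsSchauderBasis e coord)
    {C : ℝ} (hC : ∀ (x : X) (A B : Finset ℕ) (b : ℕ → ℝ), B.card ≤ A.card →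
      GreedySet coord x A →
      ‖x - ∑ i ∈ A, coord i x • e i‖ ≤ C * ‖x - ∑ i ∈ B, b i • e i‖)
    (n : ℕ) (a : ℕ → ℝ) (A : Finset ℕ) (hA : A ⊆ range n) :
    ‖∑ i ∈ range n, a i • e i - ∑ i ∈ A, a i • e i‖ ≤ C * ‖∑ i ∈ range n, a i • e i‖ := by
  set t := ∑ i ∈ range n, |a i| with ht
  have hat : ∀ i ∈ range n, |a i| ≤ t := fun i hi =>
    single_le_sum (f := fun i => |a i|) (fun i _ => abs_nonneg _) hi
  have ht0 : 0 ≤ t := sum_nonneg fun i _ => abs_nonneg _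
  set y := ∑ i ∈ range n, a i • e i + ∑ i ∈ A, (2 * t) • e i with hy
  have hcy : ∀ j, coord j y = (if j ∈ range n then a j else 0) + if j ∈ A then 2 * t else 0 := by
    intro j
    rw [hy, map_add, coord_sum hb, coord_sum hb _ (fun _ => 2 * t)]
  have hgr : GreedySet coord y A := by
    intro i hi j hj
    rw [hcy, hcy, if_pos hi, if_neg hj, if_pos (hA hi), add_zero]
    have h1 := abs_le.1 (hat i (hA hi))
    have : t ≤ |a i + 2 * t| := by
      rw [abs_of_nonneg (by linarith)]; linarith
    refine le_trans ?_ this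
    split_ifs with h
    · exact hat j h
    · simpa using ht0
  have h := hC y A A (fun _ => 2 * t) le_rfl hgr
  have e1 : y - ∑ i ∈ A, (2 * t) • e i = ∑ i ∈ range n, a i • e i := by rw [hy]; abel
  have e2 : y - ∑ i ∈ A, coord i y • e i =
      ∑ i ∈ range n, a i • e i - ∑ i ∈ A, a i • e i := by
    have : ∑ i ∈ A, coord i y • e i = ∑ i ∈ A, a i • e i + ∑ i ∈ A, (2 * t) • e i := by
      rw [← sum_add_distrib]
      refine sum_congr rfl fun i hi => ?_
      rw [hcy, if_pos hi, if_pos (hA hi), add_smul]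
    rw [this, hy]; abel
  rw [e1, e2] at h
  exact h

lemma suppression {e : ℕ → X} {coord : ℕ → X →L[ℝ] ℝ} (hb : IsSchauderBasis e coord)
    (hg : ∃ C : ℝ, IsGreedyWith e coord (fun x => ‖x‖) C) :
    ∃ K : ℝ, 1 ≤ K ∧ ∀ (x : X) (A : Finset ℕ), ‖∑ i ∈ A, coord i x • e i‖ ≤ K * ‖x‖ := by
  obtain ⟨C, hC1, hC⟩ := greedy_bound hg
  refine ⟨1 + C, by linarith, fun x A => ?_⟩
  have hlim := hb.expansion x
  have h1 : Tendsto (fun n => (1 + C) * ‖∑ i ∈ range n, coord i x • e i‖) atTop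
      (𝓝 ((1 + C) * ‖x‖)) := (hlim.norm).const_mul _
  refine ge_of_tendsto h1 ?_
  obtain ⟨n0, hn0⟩ := A.exists_nat_subset_range
  filter_upwards [eventually_ge_atTop n0] with n hn
  have hA : A ⊆ range n := hn0.trans (range_mono hn)
  have h := suppression_fin hb hC n (fun i => coord i x) A hA
  set S := ∑ i ∈ range n, coord i x • e i
  set T := ∑ i ∈ A, coord i x • e i
  have : ‖T‖ ≤ ‖S‖ + ‖S - T‖ := by
    have := norm_sub_le S (S - T)
    simpa using this
  linarith

lemma democracy {e : ℕ → X} {coord : ℕ → X →L[ℝ] ℝ} (hb : IsSchauderBasis e coord)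
    (hg : ∃ C : ℝ, IsGreedyWith e coord (fun x => ‖x‖) C) :
    ∃ D : ℝ, 1 ≤ D ∧ ∀ A B : Finset ℕ, A.card ≤ B.card →
      ‖∑ i ∈ A, e i‖ ≤ D * ‖∑ i ∈ B, e i‖ := by
  obtain ⟨C, hC1, hC⟩ := greedy_bound hg
  have hdis : ∀ A B : Finset ℕ, Disjoint A B → A.card ≤ B.card →
      ‖∑ i ∈ A, e i‖ ≤ C * ‖∑ i ∈ B, e i‖ := by
    intro A B hAB hc
    set x := ∑ i ∈ A, e i + ∑ i ∈ B, e i with hx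
    have hcx : ∀ j, coord j x = (if j ∈ A then 1 else 0) + if j ∈ B then 1 else 0 := by
      intro j
      rw [hx, map_add, coord_sum_one hb, coord_sum_one hb]
    have hgr : GreedySet coord x B := by
      intro i hi j hj
      have hiA : i ∉ A := fun h => disjoint_left.1 hAB h hi
      rw [hcx, hcx, if_pos hi, if_neg hj, if_neg hiA]
      split_ifs <;> simp
    have h := hC x B A (fun _ => 1) hc hgr
    have e1 : x - ∑ i ∈ A, (1 : ℝ) • e i = ∑ i ∈ B, e i := by
      simp [hx]
    have e2 : x - ∑ i ∈ B, coord i x • e i = ∑ i ∈ A, e i := by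
      have : ∑ i ∈ B, coord i x • e i = ∑ i ∈ B, e i := by
        refine sum_congr rfl fun i hi => ?_
        have hiA : i ∉ A := fun h => disjoint_left.1 hAB h hi
        rw [hcx, if_pos hi, if_neg hiA]; simp
      rw [this, hx]; abel
    rw [e1, e2] at h
    exact h
  refine ⟨C * C, by nlinarith, fun A B hc => ?_⟩
  obtain ⟨D, hD1, hD2⟩ := Infinite.exists_superset_card_eq (A ∪ B) ((A ∪ B).card + A.card) (by omega)
  have hcard : (D \ (A ∪ B)).card = A.card := by
    rw [card_sdiff_of_subset hD1]; omega
  have d1 : Disjoint A (D \ (A ∪ B)) :=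
    (disjoint_sdiff (s := A ∪ B) (t := D)).mono_left subset_union_left
  have d2 : Disjoint (D \ (A ∪ B)) B :=
    ((disjoint_sdiff (s := A ∪ B) (t := D)).mono_left subset_union_right).symm
  have h1 := hdis _ _ d1 hcard.ge
  have h2 := hdis _ _ d2 (by omega)
  calc _ ≤ _ := h1
    _ ≤ C * (C * ‖∑ i ∈ B, e i‖) := by gcongr
    _ = _ := by ring

lemma abs_sum_bound {e : ℕ → X} {coord : ℕ → X →L[ℝ] ℝ} {K : ℝ}
    (hK : ∀ (x : X) (A : Finset ℕ), ‖∑ i ∈ A, coord i x • e i‖ ≤ K * ‖x‖)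
    (f : X →L[ℝ] ℝ) (hf : ‖f‖ ≤ 1) (A : Finset ℕ) (x : X) :
    ∑ i ∈ A, |coord i x| * |f (e i)| ≤ 2 * K * ‖x‖ := by
  have key : ∀ B : Finset ℕ, |∑ i ∈ B, coord i x * f (e i)| ≤ K * ‖x‖ := by
    intro B
    have h1 : ∑ i ∈ B, coord i x * f (e i) = f (∑ i ∈ B, coord i x • e i) := by
      simp [map_sum]
    rw [h1, ← Real.norm_eq_abs]
    calc _ ≤ ‖f‖ * ‖∑ i ∈ B, coord i x • e i‖ := f.le_opNorm _
      _ ≤ 1 * ‖∑ i ∈ B, coord i x • e i‖ := by gcongr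
      _ ≤ _ := by rw [one_mul]; exact hK x B
  classical
  have h2 : ∑ i ∈ A, |coord i x| * |f (e i)| =
      ∑ i ∈ A with 0 ≤ coord i x * f (e i), coord i x * f (e i) -
      ∑ i ∈ A with ¬ 0 ≤ coord i x * f (e i), coord i x * f (e i) := by
    rw [← sum_filter_add_sum_filter_not A (fun i => 0 ≤ coord i x * f (e i)), sub_eq_add_neg,
      ← sum_neg_distrib]
    congr 1
    · refine sum_congr rfl fun i hi => ?_
      rw [← abs_mul, abs_of_nonneg (mem_filter.1 hi).2]
    · refine sum_congr rfl fun i hi => ?_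
      rw [← abs_mul, abs_of_neg (not_le.1 (mem_filter.1 hi).2)]
  rw [h2]
  have h3 := abs_le.1 (key {i ∈ A | 0 ≤ coord i x * f (e i)})
  have h4 := abs_le.1 (key {i ∈ A | ¬ 0 ≤ coord i x * f (e i)})
  linarith

/-- The fundamental function is comparable with the norms of indicator vectors. -/
lemma fundFn_compare {e : ℕ → X} {D : ℝ}
    (hD : ∀ A B : Finset ℕ, A.card ≤ B.card → ‖∑ i ∈ A, e i‖ ≤ D * ‖∑ i ∈ B, e i‖)
    (A : Finset ℕ) :
    ‖∑ i ∈ A, e i‖ ≤ fundFn e (fun x => ‖x‖) A.card ∧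
      fundFn e (fun x => ‖x‖) A.card ≤ D * ‖∑ i ∈ A, e i‖ := by
  constructor
  · refine le_csSup ⟨D * ‖∑ i ∈ A, e i‖, ?_⟩ ⟨A, le_rfl, rfl⟩
    rintro _ ⟨B, hB, rfl⟩
    exact hD B A hB
  · refine csSup_le ⟨_, A, le_rfl, rfl⟩ ?_
    rintro _ ⟨B, hB, rfl⟩
    exact hD B A hB

/-- Every finite set contains a large proportion on which the `ℓ₁`-sum is controlled. -/
lemma good_step {e : ℕ → X} {coord : ℕ → X →L[ℝ] ℝ} (hb : IsSchauderBasis e coord) {K : ℝ}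
    (hK1 : 1 ≤ K)
    (hK : ∀ (x : X) (A : Finset ℕ), ‖∑ i ∈ A, coord i x • e i‖ ≤ K * ‖x‖)
    (lam : ℕ → ℝ) (lpos : ∀ n, 1 ≤ n → 0 < lam n)
    (lsqrt : ∀ m n : ℕ, 1 ≤ m → m ≤ n → lam m ≤ √((n : ℝ) / m) * lam n)
    {c C : ℝ} (hc : 0 < c) (hC : 0 < C)
    (hlow : ∀ A : Finset ℕ, A.Nonempty → c * (A.card * lam A.card) ≤ ‖∑ i ∈ A, e i‖)
    (hup : ∀ A : Finset ℕ, A.Nonempty → ‖∑ i ∈ A, e i‖ ≤ C * (A.card * lam A.card)) :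
    ∃ ρ : ℝ, 0 < ρ ∧ ρ ≤ 1 ∧ ∃ K0 : ℝ, 0 < K0 ∧ ∀ E : Finset ℕ, E.Nonempty → ∃ E' ⊆ E,
      ρ * E.card ≤ E'.card ∧ ∀ x, lam E.card * ∑ i ∈ E', |coord i x| ≤ K0 * ‖x‖ := by
  have hρ : 0 < min 1 ((c / (4 * K * C)) ^ 2) := by positivity
  refine ⟨min 1 ((c / (4 * K * C)) ^ 2), hρ, min_le_left _ _, 4 * K / c, by positivity,
    fun E hE => ?_⟩
  have hn1 : 1 ≤ E.card := hE.card_pos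
  have hn0 : (0 : ℝ) < E.card := by exact_mod_cast hn1
  have hl := lpos _ hn1
  have hElow := hlow E hE
  have hne : ∑ i ∈ E, e i ≠ 0 := by
    intro h
    rw [h, norm_zero] at hElow
    have : 0 < c * (E.card * lam E.card) := by positivity
    linarith
  obtain ⟨f, hf1, hf2⟩ := exists_dual_vector ℝ _ (norm_ne_zero_iff.2 hne)
  have hf2' : f (∑ i ∈ E, e i) = ‖∑ i ∈ E, e i‖ := by simpa using hf2
  have hsum : c * (E.card * lam E.card) ≤ ∑ i ∈ E, |f (e i)| := by
    refine hElow.trans ?_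
    rw [← hf2', map_sum]
    exact sum_le_sum fun i _ => le_abs_self _
  classical
  set τ := c / 2 * lam E.card with hτ
  have hτ0 : 0 < τ := by positivity
  set E' := E.filter (fun i => τ ≤ |f (e i)|) with hE'
  have hrest : ∑ i ∈ E with ¬ τ ≤ |f (e i)|, |f (e i)| ≤ E.card * τ := by
    calc _ ≤ ∑ i ∈ E with ¬ τ ≤ |f (e i)|, τ :=
          sum_le_sum fun i hi => (not_le.1 (mem_filter.1 hi).2).le
      _ ≤ ∑ i ∈ E, τ := sum_le_sum_of_subset_of_nonneg (filter_subset _ _) fun _ _ _ => hτ0.le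
      _ = _ := by simp
  have hsplit := sum_filter_add_sum_filter_not E (fun i => τ ≤ |f (e i)|) (fun i => |f (e i)|)
  have hE'sum : c / 2 * (E.card * lam E.card) ≤ ∑ i ∈ E', |f (e i)| := by
    have : (E.card : ℝ) * τ = c / 2 * (E.card * lam E.card) := by rw [hτ]; ring
    rw [← hE'] at hsplit
    linarith
  have hE'ne : E'.Nonempty := by
    rw [nonempty_iff_ne_empty]
    intro h
    rw [h, sum_empty] at hE'sum
    have : 0 < c / 2 * (E.card * lam E.card) := mul_pos (by linarith) (mul_pos hn0 hl)
    linarith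
  have hsub : E' ⊆ E := filter_subset _ _
  have hm1 : 1 ≤ E'.card := hE'ne.card_pos
  have hm0 : (0 : ℝ) < E'.card := by exact_mod_cast hm1
  have hmn : E'.card ≤ E.card := card_le_card hsub
  have hτE' : ∀ i ∈ E', τ ≤ |f (e i)| := fun i hi => (mem_filter.1 hi).2
  clear hrest hsplit
  clear_value E'
  clear hE'
  refine ⟨E', hsub, ?_, fun x => ?_⟩
  · have h1 := abs_sum_bound hK f hf1.le E' (∑ i ∈ E', e i)
    have h2 : ∑ i ∈ E', |coord i (∑ i ∈ E', e i)| * |f (e i)| = ∑ i ∈ E', |f (e i)| := by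
      refine sum_congr rfl fun i hi => ?_
      rw [coord_sum_one hb, if_pos hi]; simp
    rw [h2] at h1
    have h3 := hup E' hE'ne
    have h4 := lsqrt _ _ hm1 hmn
    set m : ℝ := (E'.card : ℝ)
    set n : ℝ := (E.card : ℝ)
    clear_value m n
    have h5 : c / 2 * (n * lam E.card) ≤ 2 * K * (C * (m * (√(n / m) * lam E.card))) := by
      calc _ ≤ _ := hE'sum
        _ ≤ _ := h1
        _ ≤ 2 * K * (C * (m * lam E'.card)) := by gcongr
        _ ≤ _ := by gcongr
    have h6 : c / (4 * K * C) ≤ √(m / n) := by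
      have hs : √(n / m) * √(m / n) = 1 := by
        rw [← Real.sqrt_mul (by positivity)]
        have : n / m * (m / n) = 1 := by field_simp
        rw [this, Real.sqrt_one]
      have hs2 : √(m / n) * √(m / n) = m / n := Real.mul_self_sqrt (by positivity)
      have hs3 : m * √(n / m) = n * √(m / n) := by
        have : m = n * (√(m / n) * √(m / n)) := by rw [hs2]; field_simp
        calc m * √(n / m) = n * (√(m / n) * √(m / n)) * √(n / m) := by rw [← this]
          _ = n * √(m / n) * (√(n / m) * √(m / n)) := by ring
          _ = _ := by rw [hs, mul_one]
      have h7 : c / 2 * (n * lam E.card) ≤ 2 * K * C * √(m / n) * (n * lam E.card) := by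
        calc _ ≤ _ := h5
          _ = 2 * K * C * (m * √(n / m)) * lam E.card := by ring
          _ = _ := by rw [hs3]; ring
      have h8 := le_of_mul_le_mul_right h7 (by positivity)
      rw [div_le_iff₀ (by positivity)]
      linarith
    have h9 : (c / (4 * K * C)) ^ 2 ≤ m / n := by
      calc _ ≤ √(m / n) ^ 2 := by gcongr
        _ = _ := Real.sq_sqrt (by positivity)
    rw [← le_div_iff₀ hn0]
    exact (min_le_right _ _).trans h9
  · have h1 := abs_sum_bound hK f hf1.le E' x
    have h2 : τ * ∑ i ∈ E', |coord i x| ≤ 2 * K * ‖x‖ := by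
      refine le_trans ?_ h1
      rw [mul_sum]
      refine sum_le_sum fun i hi => ?_
      have := hτE' i hi
      rw [mul_comm]
      gcongr
    rw [hτ] at h2
    rw [div_mul_eq_mul_div, le_div_iff₀ hc]
    linarith

lemma good_iter {coord : ℕ → X →L[ℝ] ℝ}
    (lam : ℕ → ℝ) (lpos : ∀ n, 1 ≤ n → 0 < lam n)
    (ldec : ∀ m n, 1 ≤ m → m ≤ n → lam n ≤ lam m)
    {ρ K0 : ℝ} (hρ1 : ρ ≤ 1) (hK0 : 0 < K0)
    (hstep : ∀ E : Finset ℕ, E.Nonempty → ∃ E' ⊆ E,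
      ρ * E.card ≤ E'.card ∧ ∀ x, lam E.card * ∑ i ∈ E', |coord i x| ≤ K0 * ‖x‖)
    (k : ℕ) (A : Finset ℕ) (hA : A.Nonempty) :
    ∃ G ⊆ A, ((A \ G).card : ℝ) ≤ (1 - ρ) ^ k * A.card ∧
      ∀ x, lam A.card * ∑ i ∈ G, |coord i x| ≤ k * K0 * ‖x‖ := by
  induction k with
  | zero => exact ⟨∅, empty_subset _, by simp, by simp⟩
  | succ k ih =>
    obtain ⟨G, hGA, hG1, hG2⟩ := ih
    have hl := lpos _ hA.card_pos
    rcases (A \ G).eq_empty_or_nonempty with h | h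
    · refine ⟨G, hGA, ?_, fun x => (hG2 x).trans ?_⟩
      · rw [h]; simp only [card_empty, Nat.cast_zero]
        have : 0 ≤ 1 - ρ := by linarith
        positivity
      · gcongr; simp
    · obtain ⟨E', hE, hE1, hE2⟩ := hstep _ h
      have hdis : Disjoint G E' := disjoint_sdiff.mono_right hE
      refine ⟨G ∪ E', union_subset hGA (hE.trans sdiff_subset), ?_, fun x => ?_⟩
      · have h1 : A \ (G ∪ E') = (A \ G) \ E' := by rw [sdiff_sdiff_left]; rfl
        have h2 : (((A \ G) \ E').card : ℝ) = (A \ G).card - E'.card := by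
          rw [card_sdiff_of_subset hE, Nat.cast_sub (card_le_card hE)]
        rw [h1, h2, pow_succ]
        have : 0 ≤ 1 - ρ := by linarith
        nlinarith
      · rw [sum_union hdis, mul_add]
        have h3 : lam A.card * ∑ i ∈ E', |coord i x| ≤ K0 * ‖x‖ := by
          refine le_trans ?_ (hE2 x)
          have := ldec _ _ h.card_pos (card_le_card (sdiff_subset (s := A) (t := G)))
          gcongr
        have := hG2 x
        push_cast
        linarith

end Basis

end RenormAux

namespace RenormAux

open Finset Filter Topology

section Norm

variable {X : Type*} [NormedAddCommGroup X] [NormedSpace ℝ X]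

/-- `(G, m)` is good: `lam m * Σ_{i ∈ G} |x_i|` is controlled by the norm. -/
def Good (coord : ℕ → X →L[ℝ] ℝ) (lam : ℕ → ℝ) (L : ℝ) (G : Finset ℕ) (m : ℕ) : Prop :=
  1 ≤ m ∧ G.card ≤ m ∧ ∀ x, lam m * ∑ i ∈ G, |coord i x| ≤ L * ‖x‖

noncomputable def cval (coord : ℕ → X →L[ℝ] ℝ) (lam : ℕ → ℝ) (θ : ℝ) (k : ℕ) (G : ℕ → Finset ℕ)
    (m : ℕ → ℕ) (x : X) : ℝ :=
  ∑ j ∈ range k, θ ^ j * (lam (m j) * ∑ i ∈ G j, |coord i x|)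

noncomputable def dval (e : ℕ → X) (coord : ℕ → X →L[ℝ] ℝ) (c : ℝ) (f : X →L[ℝ] ℝ) (S : Finset ℕ)
    (x : X) : ℝ :=
  c * ∑ i ∈ S, |coord i x| * |f (e i)|

def Fam (e : ℕ → X) (coord : ℕ → X →L[ℝ] ℝ) (lam : ℕ → ℝ) (L θ c : ℝ) : Set (X → ℝ) :=
  {v | (∃ k G m, (∀ i j, i ≠ j → Disjoint (G i) (G j)) ∧ (∀ j, Good coord lam L (G j) (m j)) ∧
      v = cval coord lam θ k G m) ∨
    (∃ f S, ‖f‖ ≤ 1 ∧ v = dval e coord c f S)}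

noncomputable def newNorm (F : Set (X → ℝ)) (x : X) : ℝ := ⨆ v : F, v.1 x

/-- Lattice seminorms (in terms of coordinates) bounded by `M` times the norm. -/
structure LatSemi (coord : ℕ → X →L[ℝ] ℝ) (M : ℝ) (v : X → ℝ) : Prop where
  add : ∀ x y, v (x + y) ≤ v x + v y
  smul : ∀ (a : ℝ) x, v (a • x) = |a| * v x
  mono : ∀ x y, (∀ i, |coord i x| ≤ |coord i y|) → v x ≤ v y
  bound : ∀ x, v x ≤ M * ‖x‖

lemma newNorm_latSemi (coord : ℕ → X →L[ℝ] ℝ) (M : ℝ) (F : Set (X → ℝ)) (hne : F.Nonempty)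
    (hF : ∀ v ∈ F, LatSemi coord M v) :
    LatSemi coord M (newNorm F) ∧ ∀ v ∈ F, ∀ x, v x ≤ newNorm F x := by
  have hne' : Nonempty F := hne.to_subtype
  have hbdd : ∀ x, BddAbove (Set.range fun v : F => v.1 x) := fun x =>
    ⟨M * ‖x‖, by rintro _ ⟨v, rfl⟩; exact (hF v.1 v.2).bound x⟩
  have hle : ∀ v ∈ F, ∀ x, v x ≤ newNorm F x := fun v hv x => le_ciSup (hbdd x) ⟨v, hv⟩
  refine ⟨⟨fun x y => ?_, fun a x => ?_, fun x y h => ?_, fun x => ?_⟩, hle⟩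
  · exact ciSup_le fun v => ((hF v.1 v.2).add x y).trans
      (add_le_add (hle _ v.2 _) (hle _ v.2 _))
  · unfold newNorm
    rw [Real.mul_iSup_of_nonneg (abs_nonneg a)]
    exact iSup_congr fun v => (hF v.1 v.2).smul a x
  · exact ciSup_le fun v => ((hF v.1 v.2).mono x y h).trans (hle _ v.2 _)
  · exact ciSup_le fun v => (hF v.1 v.2).bound x

lemma geom_le (η : ℝ) (hη : 0 < η) (hη1 : η < 1) (k : ℕ) : ∑ j ∈ range k, (1 - η) ^ j ≤ 1 / η := by
  have h := geom_sum_eq (x := 1 - η) (by linarith) k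
  have h2 : 0 ≤ (1 - η) ^ k := pow_nonneg (by linarith) k
  rw [h, le_div_iff₀ hη, div_mul_eq_mul_div, div_le_iff_of_neg (by linarith)]
  nlinarith

lemma cval_latSemi (coord : ℕ → X →L[ℝ] ℝ) (lam : ℕ → ℝ) (lpos : ∀ n, 1 ≤ n → 0 < lam n)
    {L η : ℝ} (hL : 0 < L) (hη : 0 < η) (hη1 : η < 1) (k : ℕ) (G : ℕ → Finset ℕ)
    (m : ℕ → ℕ) (hgood : ∀ j, Good coord lam L (G j) (m j)) :
    LatSemi coord (L / η) (cval coord lam (1 - η) k G m) := by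
  have hθ : 0 < 1 - η := by linarith
  have hl : ∀ j, 0 < lam (m j) := fun j => lpos _ (hgood j).1
  refine ⟨fun x y => ?_, fun a x => ?_, fun x y h => ?_, fun x => ?_⟩
  · unfold cval
    rw [← sum_add_distrib]
    refine sum_le_sum fun j _ => ?_
    rw [← mul_add, ← mul_add, ← sum_add_distrib]
    have := hl j
    gcongr with i hi
    rw [map_add]
    exact abs_add_le _ _
  · unfold cval
    rw [mul_sum]
    refine sum_congr rfl fun j _ => ?_
    have : ∑ i ∈ G j, |coord i (a • x)| = |a| * ∑ i ∈ G j, |coord i x| := by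
      rw [mul_sum]
      exact sum_congr rfl fun i _ => by simp [abs_mul]
    rw [this]; ring
  · unfold cval
    refine sum_le_sum fun j _ => ?_
    refine mul_le_mul_of_nonneg_left ?_ (by positivity)
    exact mul_le_mul_of_nonneg_left (sum_le_sum fun i _ => h i) (hl j).le
  · unfold cval
    calc _ ≤ ∑ j ∈ range k, (1 - η) ^ j * (L * ‖x‖) := by
          refine sum_le_sum fun j _ => ?_
          have := (hgood j).2.2 x
          gcongr
      _ = (∑ j ∈ range k, (1 - η) ^ j) * (L * ‖x‖) := by rw [sum_mul]
      _ ≤ (1 / η) * (L * ‖x‖) := by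
          gcongr
          exact geom_le η hη hη1 k
      _ = _ := by ring

lemma dval_latSemi {e : ℕ → X} {coord : ℕ → X →L[ℝ] ℝ} {K c : ℝ} (hc : 0 < c)
    (hK : ∀ (x : X) (A : Finset ℕ), ‖∑ i ∈ A, coord i x • e i‖ ≤ K * ‖x‖)
    (f : X →L[ℝ] ℝ) (hf : ‖f‖ ≤ 1) (S : Finset ℕ) :
    LatSemi coord (c * (2 * K)) (dval e coord c f S) := by
  refine ⟨fun x y => ?_, fun a x => ?_, fun x y h => ?_, fun x => ?_⟩
  · unfold dval
    rw [← mul_add, ← sum_add_distrib]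
    gcongr with i hi
    rw [← add_mul, map_add]
    gcongr
    exact abs_add_le _ _
  · unfold dval
    have : ∑ i ∈ S, |coord i (a • x)| * |f (e i)| = |a| * ∑ i ∈ S, |coord i x| * |f (e i)| := by
      rw [mul_sum]
      exact sum_congr rfl fun i _ => by simp [abs_mul, mul_assoc]
    rw [this]; ring
  · unfold dval
    refine mul_le_mul_of_nonneg_left (sum_le_sum fun i _ => ?_) hc.le
    exact mul_le_mul_of_nonneg_right (h i) (abs_nonneg _)
  · unfold dval
    rw [mul_assoc]
    gcongr
    exact abs_sum_bound hK f hf S x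

/-- The comparison for the functionals of the first kind. -/
lemma cval_compare (e : ℕ → X) (coord : ℕ → X →L[ℝ] ℝ) (lam : ℕ → ℝ)
    (lpos : ∀ n, 1 ≤ n → 0 < lam n)
    (ldec : ∀ m n, 1 ≤ m → m ≤ n → lam n ≤ lam m)
    (lsqrt : ∀ m n : ℕ, 1 ≤ m → m ≤ n → lam m ≤ √((n : ℝ) / m) * lam n)
    {η R : ℝ} (hη : 0 < η) (hη1 : η < 1) (hR : 1 / η ^ 2 ≤ R)
    (lslow : ∀ m n : ℕ, 1 ≤ m → m ≤ n → (n : ℝ) ≤ R ^ 2 * m → lam m ≤ (1 + η) * lam n)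
    {L c : ℝ}
    (nn : X → ℝ) (hnn : ∀ v ∈ Fam e coord lam L (1 - η) c, ∀ x, v x ≤ nn x)
    {x y : X} {A B A' : Finset ℕ} {s : ℝ} (hs : 0 ≤ s) (hA : A.Nonempty) (hBA : B.card ≤ A.card)
    (hA' : A' ⊆ A) (hA'card : (1 - η) * A.card ≤ A'.card)
    (hA'good : Good coord lam L A' A.card)
    (hyA : ∀ i ∈ A, coord i y = 0)
    (hyx : ∀ i, i ∉ B → |coord i y| ≤ |coord i x|)
    (hxs : ∀ i ∈ A, s ≤ |coord i x|) (hys : ∀ i, |coord i y| ≤ s)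
    (k : ℕ) (G : ℕ → Finset ℕ) (m : ℕ → ℕ) (hdis : ∀ i j, i ≠ j → Disjoint (G i) (G j))
    (hgood : ∀ j, Good coord lam L (G j) (m j)) :
    ∃ V : ℝ, 0 ≤ V ∧
      cval coord lam (1 - η) k G m y ≤ (1 + 2 * η) * (s * (A.card * lam A.card)) + V ∧
      (1 - η) * (s * (A.card * lam A.card)) + (1 - η) * V ≤ nn x := by
  classical
  have hθ : 0 < 1 - η := by linarith
  have hl : ∀ j, 0 < lam (m j) := fun j => lpos _ (hgood j).1
  have hn1 : 1 ≤ A.card := hA.card_pos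
  have hn0 : (0 : ℝ) < A.card := by exact_mod_cast hn1
  have hln := lpos _ hn1
  have hRpos : 0 < R := lt_of_lt_of_le (by positivity) hR
  set n := A.card with hn
  set H : ℕ → Finset ℕ := fun j => if R ^ 2 * m j ≤ n then ∅ else G j \ (A ∪ B) with hH
  set V := ∑ j ∈ range k, (1 - η) ^ j * (lam (m j) * ∑ i ∈ H j, |coord i x|) with hV
  have hHG : ∀ j, H j ⊆ G j := by
    intro j; simp only [hH]; split_ifs
    · exact empty_subset _
    · exact sdiff_subset
  have hHA : ∀ j, Disjoint (H j) A := by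
    intro j; simp only [hH]; split_ifs
    · exact disjoint_empty_left _
    · exact (disjoint_sdiff.symm).mono_right subset_union_left
  refine ⟨V, sum_nonneg fun j _ => ?_, ?_, ?_⟩
  · have := hl j
    have : 0 ≤ ∑ i ∈ H j, |coord i x| := sum_nonneg fun _ _ => abs_nonneg _
    positivity
  · have hterm : ∀ j, (1 - η) ^ j * (lam (m j) * ∑ i ∈ G j, |coord i y|) ≤
        (1 - η) ^ j * (s * (η ^ 2 * (n * lam n))) +
        (1 + η) * lam n * s * (G j ∩ B).card +
        (1 - η) ^ j * (lam (m j) * ∑ i ∈ H j, |coord i x|) := by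
      intro j
      have hlj := hl j
      have hp : 0 < (1 - η) ^ j := by positivity
      have hp1 : (1 - η) ^ j ≤ 1 := pow_le_one₀ hθ.le (by linarith)
      by_cases hj : R ^ 2 * m j ≤ n
      · have hm1 := (hgood j).1
        have hm0 : (0 : ℝ) < m j := by exact_mod_cast hm1
        have hHj : H j = ∅ := by simp only [hH, if_pos hj]
        rw [hHj, sum_empty, mul_zero, mul_zero, add_zero]
        have hR1 : 1 ≤ R := by
          refine le_trans ?_ hR
          rw [le_div_iff₀ (by positivity)]
          nlinarith
        have hmn' : (m j : ℝ) ≤ n := by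
          have : 1 ≤ R ^ 2 := one_le_pow₀ hR1
          nlinarith
        have hmn : m j ≤ n := by exact_mod_cast hmn'
        have h1 := lsqrt _ _ hm1 hmn
        have h2 : ∑ i ∈ G j, |coord i y| ≤ m j * s := by
          calc _ ≤ ∑ i ∈ G j, s := sum_le_sum fun i _ => hys i
            _ = (G j).card * s := by simp
            _ ≤ _ := by
              have : ((G j).card : ℝ) ≤ m j := by exact_mod_cast (hgood j).2.1
              gcongr
        have h3 : (m j : ℝ) * √(n / m j) ≤ η ^ 2 * n := by
          have hsq : √((n : ℝ) / m j) ^ 2 = n / m j := Real.sq_sqrt (by positivity)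
          have hr : R ≤ √((n : ℝ) / m j) := by
            apply Real.le_sqrt_of_sq_le
            rw [le_div_iff₀ hm0]; exact hj
          have hq0 : 0 < √((n : ℝ) / m j) := by linarith
          have h4 : (n : ℝ) = m j * √((n : ℝ) / m j) ^ 2 := by rw [hsq]; field_simp
          have h5 : 1 ≤ η ^ 2 * √((n : ℝ) / m j) := by
            have := hR.trans hr
            rw [div_le_iff₀ (by positivity)] at this
            linarith
          calc (m j : ℝ) * √(n / m j) = (m j * √(n / m j)) * 1 := by ring
            _ ≤ (m j * √(n / m j)) * (η ^ 2 * √((n : ℝ) / m j)) :=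
              mul_le_mul_of_nonneg_left h5 (mul_nonneg hm0.le (Real.sqrt_nonneg _))
            _ = η ^ 2 * (m j * √((n : ℝ) / m j) ^ 2) := by ring
            _ = _ := by rw [← h4]
        have h4 : lam (m j) * ∑ i ∈ G j, |coord i y| ≤ s * (η ^ 2 * (n * lam n)) := by
          calc _ ≤ (√((n : ℝ) / m j) * lam n) * (m j * s) := by gcongr
            _ = s * ((m j * √((n : ℝ) / m j)) * lam n) := by ring
            _ ≤ s * ((η ^ 2 * n) * lam n) := by gcongr
            _ = _ := by ring
        have h5 : 0 ≤ (1 + η) * lam n * s * (G j ∩ B).card :=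
          mul_nonneg (by positivity) (Nat.cast_nonneg _)
        have h6 := mul_le_mul_of_nonneg_left h4 hp.le
        linarith
      · have hHj : H j = G j \ (A ∪ B) := by simp only [hH, if_neg hj]
        have hm1 := (hgood j).1
        have hlm : lam (m j) ≤ (1 + η) * lam n := by
          rcases le_total (m j) n with h | h
          · exact lslow _ _ hm1 h (not_le.1 hj).le
          · have := ldec _ _ hn1 h
            nlinarith
        have hsplit : ∑ i ∈ G j, |coord i y| ≤ s * (G j ∩ B).card + ∑ i ∈ H j, |coord i x| := by
          rw [← sum_inter_add_sum_sdiff (G j) B]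
          have h1 : ∑ i ∈ G j ∩ B, |coord i y| ≤ s * (G j ∩ B).card := by
            calc _ ≤ ∑ i ∈ G j ∩ B, s := sum_le_sum fun i _ => hys i
              _ = _ := by simp [mul_comm]
          have h2 : ∑ i ∈ G j \ B, |coord i y| ≤ ∑ i ∈ H j, |coord i x| := by
            rw [hHj]
            have hsub : G j \ (A ∪ B) ⊆ G j \ B := sdiff_subset_sdiff le_rfl subset_union_right
            rw [← sum_subset hsub]
            · refine sum_le_sum fun i hi => hyx i ?_
              simp only [Finset.mem_sdiff, mem_union, not_or] at hi
              exact hi.2.2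
            · intro i hi hi'
              simp only [Finset.mem_sdiff, mem_union, not_or, not_and, not_not] at hi hi'
              by_cases hiA : i ∈ A
              · simp [hyA i hiA]
              · exact absurd (hi' hi.1 hiA) hi.2
          linarith
        have h0 : 0 ≤ (1 - η) ^ j * (s * (η ^ 2 * (n * lam n))) := by positivity
        have h1 : (1 - η) ^ j * (lam (m j) * ∑ i ∈ G j, |coord i y|) ≤
            (1 - η) ^ j * (lam (m j) * (s * (G j ∩ B).card + ∑ i ∈ H j, |coord i x|)) := by
          gcongr
        have h2 : (1 - η) ^ j * (lam (m j) * (s * (G j ∩ B).card)) ≤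
            (1 + η) * lam n * s * (G j ∩ B).card := by
          calc _ ≤ 1 * (((1 + η) * lam n) * (s * (G j ∩ B).card)) := by gcongr
            _ = _ := by ring
        have h3 : (1 - η) ^ j * (lam (m j) * (s * (G j ∩ B).card + ∑ i ∈ H j, |coord i x|)) =
          (1 - η) ^ j * (lam (m j) * (s * (G j ∩ B).card)) +
          (1 - η) ^ j * (lam (m j) * ∑ i ∈ H j, |coord i x|) := by ring
        linarith
    have hcardB : ∑ j ∈ range k, ((G j ∩ B).card : ℝ) ≤ n := by
      have h1 : ∑ j ∈ range k, (G j ∩ B).card = ((range k).biUnion fun j => G j ∩ B).card := by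
        rw [card_biUnion]
        intro i _ j _ hij
        exact (hdis i j hij).mono inter_subset_left inter_subset_left
      have h2 : ((range k).biUnion fun j => G j ∩ B) ⊆ B :=
        biUnion_subset.2 fun j _ => inter_subset_right
      have h3 := card_le_card h2
      rw [← h1] at h3
      exact_mod_cast h3.trans hBA
    unfold cval
    refine (sum_le_sum fun j _ => hterm j).trans ?_
    rw [sum_add_distrib, sum_add_distrib, ← sum_mul, ← mul_sum]
    have hg := geom_le η hη hη1 k
    have h1 : (∑ j ∈ range k, (1 - η) ^ j) * (s * (η ^ 2 * (n * lam n))) ≤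
        η * (s * (n * lam n)) := by
      calc _ ≤ 1 / η * (s * (η ^ 2 * (n * lam n))) := by gcongr
        _ = _ := by field_simp
    have h2 : (1 + η) * lam n * s * ∑ j ∈ range k, ((G j ∩ B).card : ℝ) ≤
        (1 + η) * lam n * s * n := by gcongr
    have h3 : (1 + 2 * η) * (s * (n * lam n)) =
      η * (s * (n * lam n)) + (1 + η) * lam n * s * n := by ring
    rw [h3]
    gcongr
  · set G' : ℕ → Finset ℕ := fun j => Nat.casesOn j A' H with hG'
    set m' : ℕ → ℕ := fun j => Nat.casesOn j n m with hm'
    have hmem : cval coord lam (1 - η) (k + 1) G' m' ∈ Fam e coord lam L (1 - η) c := by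
      refine Or.inl ⟨k + 1, G', m', ?_, ?_, rfl⟩
      · intro i j hij
        rcases i with _ | i <;> rcases j with _ | j
        · exact absurd rfl hij
        · exact ((hHA j).mono_right hA').symm
        · exact (hHA i).mono_right hA'
        · exact (hdis i j (by omega)).mono (hHG i) (hHG j)
      · intro j
        rcases j with _ | j
        · exact hA'good
        · refine ⟨(hgood j).1, (card_le_card (hHG j)).trans (hgood j).2.1, fun x => ?_⟩
          refine le_trans ?_ ((hgood j).2.2 x)
          have := hl j
          have h : ∑ i ∈ H j, |coord i x| ≤ ∑ i ∈ G j, |coord i x| :=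
            sum_le_sum_of_subset_of_nonneg (hHG j) fun _ _ _ => abs_nonneg _
          exact mul_le_mul_of_nonneg_left h this.le
    refine le_trans ?_ (hnn _ hmem x)
    unfold cval
    rw [sum_range_succ']
    have h1 : ∑ j ∈ range k, (1 - η) ^ (j + 1) * (lam (m' (j + 1)) * ∑ i ∈ G' (j + 1), |coord i x|)
        = (1 - η) * V := by
      rw [hV, mul_sum]
      refine sum_congr rfl fun j _ => ?_
      simp only [hG', hm']
      rw [pow_succ]; ring
    have h2 : (1 - η) * (s * (n * lam n)) ≤
        (1 - η) ^ 0 * (lam (m' 0) * ∑ i ∈ G' 0, |coord i x|) := by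
      simp only [hG', hm', pow_zero, one_mul]
      have h3 : s * A'.card ≤ ∑ i ∈ A', |coord i x| := by
        calc s * A'.card = ∑ i ∈ A', s := by simp [mul_comm]
          _ ≤ _ := sum_le_sum fun i hi => hxs i (hA' hi)
      calc (1 - η) * (s * (n * lam n)) = lam n * (s * ((1 - η) * n)) := by ring
        _ ≤ lam n * (s * A'.card) := by gcongr
        _ ≤ lam n * ∑ i ∈ A', |coord i x| := by gcongr
    rw [h1]
    linarith

/-- The comparison for the functionals of the second kind. -/
lemma dval_compare {e : ℕ → X} {coord : ℕ → X →L[ℝ] ℝ} (hb : IsSchauderBasis e coord)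
    {K : ℝ}
    (hK : ∀ (x : X) (A : Finset ℕ), ‖∑ i ∈ A, coord i x • e i‖ ≤ K * ‖x‖)
    {c : ℝ} (hc : 0 < c) (nn : X → ℝ)
    (hnn : ∀ f S, ‖f‖ ≤ 1 → ∀ x, dval e coord c f S x ≤ nn x)
    {x y : X} {B : Finset ℕ} {s : ℝ} (hs : 0 ≤ s)
    (hyx : ∀ i, i ∉ B → |coord i y| ≤ |coord i x|) (hys : ∀ i, |coord i y| ≤ s)
    (f : X →L[ℝ] ℝ) (hf : ‖f‖ ≤ 1) (S : Finset ℕ) :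
    dval e coord c f S y ≤ nn x + s * (c * (2 * K * ‖∑ i ∈ B, e i‖)) := by
  classical
  refine le_trans ?_ (add_le_add_left (hnn f S hf x) _)
  unfold dval
  have h0 : ∑ i ∈ S, |coord i y| * |f (e i)| ≤
      ∑ i ∈ S, |coord i x| * |f (e i)| + s * ∑ i ∈ B, |f (e i)| := by
    rw [← sum_inter_add_sum_sdiff S B]
    have h1 : ∑ i ∈ S ∩ B, |coord i y| * |f (e i)| ≤ s * ∑ i ∈ B, |f (e i)| := by
      rw [mul_sum]
      calc _ ≤ ∑ i ∈ S ∩ B, s * |f (e i)| := sum_le_sum fun i _ => by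
            have := hys i
            gcongr
        _ ≤ _ := sum_le_sum_of_subset_of_nonneg inter_subset_right fun _ _ _ => by positivity
    have h2 : ∑ i ∈ S \ B, |coord i y| * |f (e i)| ≤ ∑ i ∈ S, |coord i x| * |f (e i)| := by
      calc _ ≤ ∑ i ∈ S \ B, |coord i x| * |f (e i)| := sum_le_sum fun i hi => by
            have := hyx i (Finset.mem_sdiff.1 hi).2
            gcongr
        _ ≤ _ := sum_le_sum_of_subset_of_nonneg sdiff_subset fun _ _ _ => by positivity
    linarith
  have h1 := abs_sum_bound hK f hf B (∑ i ∈ B, e i)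
  have h2 : ∑ i ∈ B, |coord i (∑ i ∈ B, e i)| * |f (e i)| = ∑ i ∈ B, |f (e i)| := by
    refine sum_congr rfl fun i hi => ?_
    rw [coord_sum_one hb, if_pos hi]; simp
  rw [h2] at h1
  calc _ ≤ c * (∑ i ∈ S, |coord i x| * |f (e i)| + s * ∑ i ∈ B, |f (e i)|) := by gcongr
    _ ≤ c * (∑ i ∈ S, |coord i x| * |f (e i)| + s * (2 * K * ‖∑ i ∈ B, e i‖)) := by gcongr
    _ = _ := by ring

end Norm

end RenormAux

namespace RenormAux

open Finset Filter Topology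

variable {X : Type*} [NormedAddCommGroup X] [NormedSpace ℝ X]

lemma LatSemi.weaken {coord : ℕ → X →L[ℝ] ℝ} {M M' : ℝ} {v : X → ℝ} (h : LatSemi coord M v)
    (hM : M ≤ M') : LatSemi coord M' v :=
  ⟨h.add, h.smul, h.mono, fun x => (h.bound x).trans (by gcongr)⟩

lemma cval_e_le {e : ℕ → X} {coord : ℕ → X →L[ℝ] ℝ} (hb : IsSchauderBasis e coord)
    (lam : ℕ → ℝ) (lpos : ∀ n, 1 ≤ n → 0 < lam n) (l1 : lam 1 = 1)
    (ldec : ∀ m n, 1 ≤ m → m ≤ n → lam n ≤ lam m)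
    {L η : ℝ} (hη : 0 < η) (hη1 : η < 1) (k : ℕ) (G : ℕ → Finset ℕ)
    (m : ℕ → ℕ) (hdis : ∀ i j, i ≠ j → Disjoint (G i) (G j))
    (hgood : ∀ j, Good coord lam L (G j) (m j)) (i : ℕ) :
    cval coord lam (1 - η) k G m (e i) ≤ 1 := by
  classical
  unfold cval
  have h1 : ∀ j, (1 - η) ^ j * (lam (m j) * ∑ i' ∈ G j, |coord i' (e i)|) ≤
      if i ∈ G j then 1 else 0 := by
    intro j
    have h2 : ∑ i' ∈ G j, |coord i' (e i)| = if i ∈ G j then 1 else 0 := by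
      rw [← sum_ite_eq' (G j) i (fun _ => (1 : ℝ))]
      refine sum_congr rfl fun i' _ => ?_
      rw [hb.biorth]
      split_ifs <;> simp
    rw [h2]
    have h3 : lam (m j) ≤ 1 := l1 ▸ ldec 1 (m j) le_rfl (hgood j).1
    have h4 := lpos _ (hgood j).1
    have h5 : (1 - η) ^ j ≤ 1 := pow_le_one₀ (by linarith) (by linarith)
    split_ifs
    · rw [mul_one]
      exact mul_le_one₀ h5 h4.le h3
    · simp
  refine (sum_le_sum fun j _ => h1 j).trans ?_
  rw [← sum_filter, sum_const, nsmul_eq_mul, mul_one]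
  have : ((range k).filter (fun j => i ∈ G j)).card ≤ 1 := by
    rw [card_le_one]
    intro a ha b hb'
    by_contra hab
    exact disjoint_left.1 (hdis a b hab) (mem_filter.1 ha).2 (mem_filter.1 hb').2
  exact_mod_cast this

lemma lower_bound {e : ℕ → X} {coord : ℕ → X →L[ℝ] ℝ} (hb : IsSchauderBasis e coord)
    {c : ℝ} (hc : 0 < c) (nn : X → ℝ)
    (hnn : ∀ f S, ‖f‖ ≤ 1 → ∀ x, dval e coord c f S x ≤ nn x) (x : X) : c * ‖x‖ ≤ nn x := by
  by_cases hx : x = 0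
  · have := hnn 0 ∅ (by simp) x
    simp only [dval, sum_empty, mul_zero] at this
    simpa [hx] using this
  obtain ⟨f, hf1, hf2⟩ := exists_dual_vector ℝ x (norm_ne_zero_iff.2 hx)
  have hf2' : f x = ‖x‖ := by simpa using hf2
  have hlim : Tendsto (fun n => c * f (∑ i ∈ range n, coord i x • e i)) atTop (𝓝 (c * f x)) :=
    ((f.continuous.tendsto x).comp (hb.expansion x)).const_mul c
  rw [← hf2']
  refine le_of_tendsto hlim (Eventually.of_forall fun n => ?_)
  refine le_trans ?_ (hnn f (range n) hf1.le x)
  unfold dval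
  gcongr
  rw [map_sum]
  refine sum_le_sum fun i _ => ?_
  rw [map_smul, smul_eq_mul, ← abs_mul]
  exact le_abs_self _

lemma greedy_of_compare {e : ℕ → X} {coord : ℕ → X →L[ℝ] ℝ} (hb : IsSchauderBasis e coord)
    {ε : ℝ} (hε : 0 < ε) (nn : X → ℝ) (h0 : ∀ x, 0 ≤ nn x)
    (hmono : ∀ x y, (∀ i, |coord i x| ≤ |coord i y|) → nn x ≤ nn y)
    (hcomp : ∀ (x y : X) (A B : Finset ℕ) (s : ℝ), 0 ≤ s → A.Nonempty → B.card ≤ A.card →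
      (∀ i ∈ A, coord i y = 0) → (∀ i, i ∉ B → |coord i y| ≤ |coord i x|) →
      (∀ i ∈ A, s ≤ |coord i x|) → (∀ i, |coord i y| ≤ s) → nn y ≤ (1 + ε) * nn x) :
    IsGreedyWith e coord nn (1 + ε) := by
  classical
  intro x m A0 hm hgr
  have hε1 : 0 < 1 + ε := by linarith
  rw [mul_comm, ← div_le_iff₀ hε1]
  refine le_csInf ⟨_, ∅, fun _ => 0, by simp, rfl⟩ ?_
  rintro _ ⟨B0, b, hB0, rfl⟩
  rw [div_le_iff₀ hε1, mul_comm]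
  set y := x - ∑ i ∈ A0, coord i x • e i with hy
  set z := x - ∑ i ∈ B0, b i • e i with hz
  have hcy : ∀ i, coord i y = if i ∈ A0 then 0 else coord i x := by
    intro i
    rw [hy, map_sub, coord_sum hb _ (fun i => coord i x)]
    split_ifs <;> simp
  have hcz : ∀ i, i ∉ B0 → coord i z = coord i x := by
    intro i hi
    rw [hz, map_sub, coord_sum hb, if_neg hi, sub_zero]
  have hyz : ∀ i, i ∉ B0 \ A0 → |coord i y| ≤ |coord i z| := by
    intro i hi
    rw [hcy]
    split_ifs with h
    · simp
    · rw [hcz i (fun h' => hi (Finset.mem_sdiff.2 ⟨h', h⟩))]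
  have hcard : (B0 \ A0).card ≤ (A0 \ B0).card := by
    have h1 := card_sdiff_add_card_inter B0 A0
    have h2 := card_sdiff_add_card_inter A0 B0
    rw [inter_comm] at h2
    omega
  rcases (A0 \ B0).eq_empty_or_nonempty with h | h
  · have hB : B0 \ A0 = ∅ := by
      rw [h, card_empty] at hcard
      exact card_eq_zero.1 (by omega)
    have h1 := hmono y z fun i => hyz i (by rw [hB]; simp)
    have := h0 z
    nlinarith
  · obtain ⟨i0, hi0, hmin⟩ := exists_min_image _ (fun i => |coord i x|) h
    refine hcomp z y (A0 \ B0) (B0 \ A0) |coord i0 x| (abs_nonneg _) h hcard ?_ hyz ?_ ?_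
    · intro i hi
      rw [hcy, if_pos (Finset.mem_sdiff.1 hi).1]
    · intro i hi
      rw [hcz i (Finset.mem_sdiff.1 hi).2]
      exact hmin i hi
    · intro i
      rw [hcy]
      split_ifs with h'
      · simp
      · exact hgr i0 (Finset.mem_sdiff.1 hi0).1 i h'

lemma main_aux (e : ℕ → X) (coord : ℕ → X →L[ℝ] ℝ) (hb : IsSchauderBasis e coord)
    (K : ℝ) (hK1 : 1 ≤ K)
    (hK : ∀ (x : X) (A : Finset ℕ), ‖∑ i ∈ A, coord i x • e i‖ ≤ K * ‖x‖)
    (D : ℝ) (hD1 : 1 ≤ D)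
    (hD : ∀ A B : Finset ℕ, A.card ≤ B.card → ‖∑ i ∈ A, e i‖ ≤ D * ‖∑ i ∈ B, e i‖)
    (φ : ℝ → ℝ) (hφ : IsFundamentalFunction φ)
    (hagree : ∀ n : ℕ, 1 ≤ n → φ (n : ℝ) = fundFn e (fun x => ‖x‖) n)
    (hδ : 0 < deltaParam φ) (ε : ℝ) (hε : 0 < ε)
    (η : ℝ) (hη : 0 < η) (hη1 : η < 1) (hηε : 1 + 2 * η ≤ (1 + ε) * (1 - η)) :
    ∃ nn : X → ℝ, IsEquivNorm nn ∧ IsNormalizedWith e nn ∧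
      IsUnconditionalWith e nn 1 ∧ IsGreedyWith e coord nn (1 + ε) := by
  classical
  set R := 1 / η ^ 2 with hR
  have hR1 : 1 ≤ R := by
    rw [hR, le_div_iff₀ (by positivity)]; nlinarith
  obtain ⟨lam, a, b, ha, hb0, l1, lpos, ldec, lsqrt, lslow, lcomp⟩ :=
    exists_lam φ hφ hδ (R ^ 2) η (one_le_pow₀ hR1) hη
  have hlow : ∀ A : Finset ℕ, A.Nonempty →
      1 / (b * D) * (A.card * lam A.card) ≤ ‖∑ i ∈ A, e i‖ := by
    intro A hA
    have h1 := (fundFn_compare hD A).2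
    rw [← hagree _ hA.card_pos] at h1
    have h2 := (lcomp _ hA.card_pos).2
    rw [one_div, inv_mul_le_iff₀ (by positivity)]
    calc _ ≤ _ := h2
      _ ≤ b * (D * ‖∑ i ∈ A, e i‖) := by gcongr
      _ = _ := by ring
  have hup : ∀ A : Finset ℕ, A.Nonempty →
      ‖∑ i ∈ A, e i‖ ≤ 1 / a * (A.card * lam A.card) := by
    intro A hA
    have h1 := (fundFn_compare hD A).1
    rw [← hagree _ hA.card_pos] at h1
    have h2 := (lcomp _ hA.card_pos).1
    rw [one_div, inv_mul_eq_div, le_div_iff₀ ha]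
    nlinarith
  set c1 := 1 / (b * D) with hc1
  set C1 := 1 / a with hC1
  have hc1p : 0 < c1 := by positivity
  have hC1p : 0 < C1 := by positivity
  obtain ⟨ρ, hρ, hρ1, K0, hK0, hstep⟩ :=
    good_step hb hK1 hK lam lpos lsqrt hc1p hC1p hlow hup
  obtain ⟨k, hk⟩ := exists_pow_lt_of_lt_one hη (show 1 - ρ < 1 by linarith)
  have hiter := good_iter lam lpos ldec hρ1 hK0 hstep k
  set L := k * K0 + K / c1 with hL
  have hLp : 0 < L := by positivity
  have hAgood : ∀ A : Finset ℕ, A.Nonempty → ∃ A' ⊆ A, (1 - η) * A.card ≤ A'.card ∧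
      Good coord lam L A' A.card := by
    intro A hA
    obtain ⟨G, hGA, hG1, hG2⟩ := hiter A hA
    refine ⟨G, hGA, ?_, hA.card_pos, card_le_card hGA, fun x => (hG2 x).trans ?_⟩
    · rw [card_sdiff_of_subset hGA, Nat.cast_sub (card_le_card hGA)] at hG1
      have : (1 - ρ) ^ k * A.card ≤ η * A.card := by gcongr
      linarith
    · gcongr
      rw [hL]
      have : 0 < K / c1 := by positivity
      linarith
  have hsingle : ∀ i, Good coord lam L {i} 1 := by
    intro i
    refine ⟨le_rfl, by simp, fun x => ?_⟩
    rw [l1, one_mul, sum_singleton]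
    have h1 := hK x {i}
    have h2 := hlow {i} (singleton_nonempty i)
    simp only [sum_singleton, card_singleton, l1, Nat.cast_one, mul_one, norm_smul,
      Real.norm_eq_abs] at h1 h2
    have h3 : |coord i x| ≤ K / c1 * ‖x‖ := by
      rw [div_mul_eq_mul_div, le_div_iff₀ hc1p]
      refine le_trans ?_ h1
      gcongr
    refine h3.trans ?_
    gcongr
    rw [hL]
    have : 0 ≤ (k : ℝ) * K0 := by positivity
    linarith
  set c := η / (2 * K * C1) with hc
  have hcp : 0 < c := by positivity
  set F := Fam e coord lam L (1 - η) c with hF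
  set M := L / η + c * (2 * K) with hM
  have hFsemi : ∀ v ∈ F, LatSemi coord M v := by
    rintro v (⟨k, G, m, _, hgood, rfl⟩ | ⟨f, S, hf, rfl⟩)
    · refine (cval_latSemi coord lam lpos hLp hη hη1 k G m hgood).weaken ?_
      have : 0 < c * (2 * K) := by positivity
      linarith
    · refine (dval_latSemi hcp hK f hf S).weaken ?_
      have : 0 < L / η := by positivity
      linarith
  have hdmem : ∀ f S, ‖f‖ ≤ 1 → dval e coord c f S ∈ F := fun f S hf => Or.inr ⟨f, S, hf, rfl⟩
  have hFne : F.Nonempty := ⟨_, hdmem 0 ∅ (by simp)⟩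
  obtain ⟨hsemi, hle⟩ := newNorm_latSemi coord M F hFne hFsemi
  set nn := newNorm F with hnn
  have hnnle : ∀ (x : X) (r : ℝ), (∀ v ∈ F, v x ≤ r) → nn x ≤ r := by
    intro x r h
    have : Nonempty F := hFne.to_subtype
    exact ciSup_le fun v => h v.1 v.2
  have hdle : ∀ f S, ‖f‖ ≤ 1 → ∀ x, dval e coord c f S x ≤ nn x :=
    fun f S hf x => hle _ (hdmem f S hf) x
  have hlb := lower_bound hb hcp nn hdle
  have hnn0 : ∀ x, 0 ≤ nn x := fun x => le_trans (by positivity) (hlb x)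
  refine ⟨nn, ⟨hsemi.add, hsemi.smul, c, M, hcp, fun x => ⟨hlb x, hsemi.bound x⟩⟩, ?_, ?_, ?_⟩
  · intro i
    apply le_antisymm
    · refine hnnle _ _ ?_
      rintro v (⟨k, G, m, hdis, hgood, rfl⟩ | ⟨f, S, hf, rfl⟩)
      · exact cval_e_le hb lam lpos l1 ldec hη hη1 k G m hdis hgood i
      · have h1 := hup {i} (singleton_nonempty i)
        simp only [sum_singleton, card_singleton, l1, Nat.cast_one, mul_one] at h1
        have h2 := (dval_latSemi hcp hK f hf S).bound (e i)
        calc _ ≤ _ := h2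
          _ ≤ c * (2 * K) * C1 := by gcongr
          _ = η := by rw [hc]; field_simp
          _ ≤ 1 := hη1.le
    · have hmem : cval coord lam (1 - η) 1 (fun j => if j = 0 then {i} else ∅) (fun _ => 1) ∈ F := by
        refine Or.inl ⟨1, _, _, ?_, ?_, rfl⟩
        · intro p q hpq
          by_cases hp : p = 0
          · have hq : q ≠ 0 := fun h => hpq (hp.trans h.symm)
            simp [hq]
          · simp [hp]
        · intro j
          by_cases hj : j = 0
          · simpa [hj] using hsingle i
          · refine ⟨le_rfl, by simp [hj], fun x => ?_⟩
            simp only [hj, if_false, sum_empty, mul_zero]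
            positivity
      have h := hle _ hmem (e i)
      simpa [cval, l1, hb.biorth] using h
  · intro s p q hpq
    rw [one_mul]
    refine hsemi.mono _ _ fun i => ?_
    rw [coord_sum hb, coord_sum hb]
    split_ifs
    · exact hpq i
    · exact le_rfl
  · refine greedy_of_compare hb hε nn hnn0 hsemi.mono ?_
    intro x y A B s hs hA hBA hyA hyx hxs hys
    obtain ⟨A', hA'A, hA'card, hA'good⟩ := hAgood A hA
    have hcomp := cval_compare e coord lam lpos ldec lsqrt hη hη1 (le_of_eq hR.symm) lslow nn hle
      hs hA hBA hA'A hA'card hA'good hyA hyx hxs hys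
    have hn0 : (0 : ℝ) < A.card := by exact_mod_cast hA.card_pos
    have hW : 0 ≤ s * (A.card * lam A.card) :=
      mul_nonneg hs (mul_nonneg hn0.le (lpos _ hA.card_pos).le)
    refine hnnle _ _ ?_
    rintro v (⟨k, G, m, hdis, hgood, rfl⟩ | ⟨f, S, hf, rfl⟩)
    · obtain ⟨V, hV, h1, h2⟩ := hcomp k G m hdis hgood
      refine h1.trans ?_
      have h3 : (1 + ε) * ((1 - η) * (s * (A.card * lam A.card)) + (1 - η) * V) ≤
        (1 + ε) * nn x := by gcongr
      have h4 : 1 ≤ (1 + ε) * (1 - η) := by linarith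
      nlinarith
    · have h1 := dval_compare hb hK hcp nn hdle hs hyx hys f hf S
      obtain ⟨V, hV, _, h2⟩ := hcomp 0 (fun _ => ∅) (fun _ => 1) (by simp) (fun j =>
        ⟨le_rfl, by simp, fun x => by simp only [sum_empty, mul_zero]; positivity⟩)
      have hBn : ‖∑ i ∈ B, e i‖ ≤ C1 * (A.card * lam A.card) := by
        have h3 := (fundFn_compare hD A).1
        have h4 : ‖∑ i ∈ B, e i‖ ≤ fundFn e (fun x => ‖x‖) A.card := by
          refine le_csSup ⟨D * ‖∑ i ∈ A, e i‖, ?_⟩ ⟨B, hBA, rfl⟩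
          rintro _ ⟨B, hB, rfl⟩
          exact hD B A hB
        rw [← hagree _ hA.card_pos] at h4
        have h5 := (lcomp _ hA.card_pos).1
        rw [hC1, one_div, inv_mul_eq_div, le_div_iff₀ ha]
        nlinarith
      have h6 : s * (c * (2 * K * ‖∑ i ∈ B, e i‖)) ≤ η * (s * (A.card * lam A.card)) := by
        calc _ ≤ s * (c * (2 * K * (C1 * (A.card * lam A.card)))) := by gcongr
          _ = (c * (2 * K * C1)) * (s * (A.card * lam A.card)) := by ring
          _ = _ := by rw [hc, div_mul_cancel₀]; positivity
      refine h1.trans ?_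
      have h7 : 0 ≤ (1 - η) * V := mul_nonneg (by linarith) hV
      have h8 : ε * ((1 - η) * (s * (A.card * lam A.card))) ≤ ε * nn x := by
        have : (1 - η) * (s * (A.card * lam A.card)) ≤ nn x := by linarith
        gcongr
      have h9 : η ≤ ε * (1 - η) := by nlinarith
      have h10 := mul_le_mul_of_nonneg_right h9 hW
      linarith

end RenormAux

/-- let `(e_i)` be a greedy Schauder basis of a Banach space `X` whose
fundamental function, extended to a fundamental function `φ` on `[1,∞)`, satisfies
`δ(φ) > 0`. Then for every `ε > 0` there is an equivalent norm on `X` w.r.t. which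
`(e_i)` is normalized, `1`-unconditional and `(1+ε)`-greedy. -/
theorem renorming_one_plus_eps_greedy_of_delta_pos
    {X : Type*} [NormedAddCommGroup X] [NormedSpace ℝ X] [CompleteSpace X]
    (e : ℕ → X) (coord : ℕ → X →L[ℝ] ℝ)
    (hbasis : IsSchauderBasis e coord)
    (hgreedy : ∃ C : ℝ, IsGreedyWith e coord (fun x => ‖x‖) C)
    (φ : ℝ → ℝ) (hφ : IsFundamentalFunction φ)
    (hagree : ∀ n : ℕ, 1 ≤ n → φ (n : ℝ) = fundFn e (fun x => ‖x‖) n)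
    (hδ : 0 < deltaParam φ)
    (ε : ℝ) (hε : 0 < ε) :
    ∃ nn : X → ℝ, IsEquivNorm nn ∧
      IsNormalizedWith e nn ∧
      IsUnconditionalWith e nn 1 ∧
      IsGreedyWith e coord nn (1 + ε) := by
  classical
  obtain ⟨K, hK1, hK⟩ := RenormAux.suppression hbasis hgreedy
  obtain ⟨D, hD1, hD⟩ := RenormAux.democracy hbasis hgreedy
  obtain ⟨η, hη, hη1, hηε⟩ : ∃ η : ℝ, 0 < η ∧ η < 1 ∧ 1 + 2 * η ≤ (1 + ε) * (1 - η) := by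
    refine ⟨ε / (3 + ε), by positivity, ?_, ?_⟩
    · rw [div_lt_one (by positivity)]; linarith
    · have h : ε / (3 + ε) * (3 + ε) = ε := by field_simp
      nlinarith
  exact RenormAux.main_aux e coord hbasis K hK1 hK D hD1 hD φ hφ hagree hδ ε hε η hη hη1 hηε
end
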